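/- arXiv:1401.6833 — 2 statements merged into one kernel-verified Lean document; each statement's English description precedes it below -/
import Mathlib

section
/- (A priori estimate for linear KdV with localized derivative forcing in the weighted space.) Let L, T > 0, 0 < ν < L, and let ρ ∈ C^∞([0,L]) satisfy ρ(x) = 0 for 0 ≤ x ≤ L−ν and ρ(x) = 1 for L−ν/2 ≤ x ≤ L. There exists a constant C > 0 such that for every h ∈ C^∞([0,T]×[0,L]) and every u ∈ C^∞([0,T]×[0,L]) satisfying u_t + u_x + u_xxx = (ρ(x)h)_x on (0,T)×(0,L) and u(t,0) = u(t,L) = u_x(t,L) = 0 for all t ∈ [0,T], one has: max_{t∈[0,T]} ∫₀^L u(t,x)²/(L−x) dx + ∫₀^T∫₀^L u_x(t,x)²/(L−x)² dx dt ≤ C ( ∫₀^L u(0,x)²/(L−x) dx + ∫₀^T∫₀^L h(t,x)² dx dt ). -/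
/-- Partial derivative in the space variable (second argument). -/
noncomputable def pdx (f : ℝ → ℝ → ℝ) : ℝ → ℝ → ℝ := fun t x => deriv (f t) x

/-- Partial derivative in the time variable (first argument). -/
noncomputable def pdt (f : ℝ → ℝ → ℝ) : ℝ → ℝ → ℝ := fun t x => deriv (fun s => f s x) t

open Set MeasureTheory

section ParametricIntegral

variable {H E : Type} [NormedAddCommGroup H] [NormedSpace ℝ H] [ProperSpace H]
  [NormedAddCommGroup E] [NormedSpace ℝ E]

/-- Differentiation under the integral sign for a `C¹` integrand on a compact interval. -/
theorem hasFDerivAt_intervalIntegral_of_contDiff {f : H × ℝ → E} (hf : ContDiff ℝ 1 f)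
    (a b : ℝ) (p : H) :
    HasFDerivAt (fun q => ∫ s in a..b, f (q, s))
      (∫ s in a..b, (fderiv ℝ f (p, s)).comp (ContinuousLinearMap.inl ℝ H ℝ)) p := by
  have hcont : Continuous fun q : H × ℝ =>
      (fderiv ℝ f q).comp (ContinuousLinearMap.inl ℝ H ℝ) :=
    (hf.continuous_fderiv one_ne_zero).clm_comp continuous_const
  obtain ⟨M, hM⟩ := ((isCompact_closedBall p 1).prod
    (isCompact_uIcc (a := a) (b := b))).exists_bound_of_continuousOn hcont.continuousOn
  refine intervalIntegral.hasFDerivAt_integral_of_dominated_of_fderiv_le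
    (F' := fun q s => (fderiv ℝ f (q, s)).comp (ContinuousLinearMap.inl ℝ H ℝ))
    (bound := fun _ => M) (Metric.ball_mem_nhds p one_pos) ?_ ?_ ?_ ?_ ?_ ?_
  · exact .of_forall fun q =>
      (hf.continuous.comp (by fun_prop : Continuous fun s : ℝ => (q, s))).aestronglyMeasurable
  · exact (hf.continuous.comp (by fun_prop : Continuous fun s : ℝ => (p, s))).intervalIntegrable _ _
  · exact (hcont.comp (by fun_prop : Continuous fun s : ℝ => (p, s))).aestronglyMeasurable
  · refine .of_forall fun s hs q hq => hM (q, s) ⟨Metric.ball_subset_closedBall hq, ?_⟩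
    exact uIoc_subset_uIcc hs
  · exact intervalIntegrable_const
  · refine .of_forall fun s _ q _ => ?_
    have h1 : HasFDerivAt (fun q : H => (q, s)) (ContinuousLinearMap.inl ℝ H ℝ) q :=
      hasFDerivAt_prodMk_left q s
    exact ((hf.differentiable one_ne_zero) (q, s)).hasFDerivAt.comp q h1

theorem ContDiff.parametric_intervalIntegral_nat (a b : ℝ) (n : ℕ) {E : Type}
    [NormedAddCommGroup E] [NormedSpace ℝ E] [CompleteSpace E] {f : H × ℝ → E}
    (hf : ContDiff ℝ n f) : ContDiff ℝ n fun q => ∫ s in a..b, f (q, s) := by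
  induction n generalizing E with
  | zero =>
    rw [Nat.cast_zero, contDiff_zero] at *
    exact intervalIntegral.continuous_parametric_intervalIntegral_of_continuous'
      (f := fun q s => f (q, s)) hf a b
  | succ n ih =>
    have h1 : ContDiff ℝ 1 f := hf.of_le (by exact_mod_cast Nat.le_add_left 1 n)
    rw [Nat.cast_succ] at hf ⊢
    rw [contDiff_succ_iff_hasFDerivAt]
    refine ⟨_, ih (f := fun q => (fderiv ℝ f q).comp (ContinuousLinearMap.inl ℝ H ℝ)) ?_,
      hasFDerivAt_intervalIntegral_of_contDiff h1 a b⟩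
    exact (hf.fderiv_right le_rfl).clm_comp contDiff_const

theorem ContDiff.parametric_intervalIntegral [CompleteSpace E] (a b : ℝ) {f : H × ℝ → E}
    (hf : ContDiff ℝ (⊤ : ℕ∞) f) : ContDiff ℝ (⊤ : ℕ∞) fun q => ∫ s in a..b, f (q, s) :=
  contDiff_infty.2 fun n => ContDiff.parametric_intervalIntegral_nat a b n (contDiff_infty.1 hf n)

end ParametricIntegral

theorem hasDerivAt_pdx {f : ℝ → ℝ → ℝ} (hf : ContDiff ℝ (⊤ : ℕ∞) (Function.uncurry f))
    (t x : ℝ) : HasDerivAt (f t) (pdx f t x) x := by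
  have h : ContDiff ℝ (⊤ : ℕ∞) (f t) :=
    hf.comp (contDiff_const.prodMk contDiff_id : ContDiff ℝ (⊤ : ℕ∞) fun x : ℝ => (t, x))
  exact (h.differentiable (by simp) x).hasDerivAt

theorem hasDerivAt_pdt {f : ℝ → ℝ → ℝ} (hf : ContDiff ℝ (⊤ : ℕ∞) (Function.uncurry f))
    (t x : ℝ) : HasDerivAt (fun s => f s x) (pdt f t x) t := by
  have h : ContDiff ℝ (⊤ : ℕ∞) (fun s => f s x) :=
    hf.comp (contDiff_id.prodMk contDiff_const : ContDiff ℝ (⊤ : ℕ∞) fun s : ℝ => (s, x))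
  exact (h.differentiable (by simp) t).hasDerivAt

theorem contDiff_pdx {f : ℝ → ℝ → ℝ} (hf : ContDiff ℝ (⊤ : ℕ∞) (Function.uncurry f)) :
    ContDiff ℝ (⊤ : ℕ∞) (Function.uncurry (pdx f)) := by
  have h : Function.uncurry (pdx f) = fun p => fderiv ℝ (Function.uncurry f) p (0, 1) := by
    ext ⟨t, x⟩
    have h1 : HasFDerivAt (Function.uncurry f) (fderiv ℝ (Function.uncurry f) (t, x)) (t, x) :=
      (hf.differentiable (by simp) (t, x)).hasFDerivAt
    exact (hasDerivAt_pdx hf t x).unique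
      (h1.comp_hasDerivAt x ((hasDerivAt_const x t).prodMk (hasDerivAt_id x)))
  rw [h]
  exact (hf.fderiv_right (by simp)).clm_apply contDiff_const

theorem pdt_eq_fderiv {f : ℝ → ℝ → ℝ} (hf : ContDiff ℝ (⊤ : ℕ∞) (Function.uncurry f))
    (t x : ℝ) : pdt f t x = fderiv ℝ (Function.uncurry f) (t, x) (1, 0) := by
  have h : HasFDerivAt (Function.uncurry f) (fderiv ℝ (Function.uncurry f) (t, x)) (t, x) :=
    (hf.differentiable (by simp) (t, x)).hasFDerivAt
  have h1 : HasDerivAt (fun s : ℝ => (s, x)) (1, 0) t :=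
    (hasDerivAt_id t).prodMk (hasDerivAt_const t x)
  have h2 : HasDerivAt (Function.uncurry f ∘ fun s => (s, x))
      (fderiv ℝ (Function.uncurry f) (t, x) (1, 0)) t := h.comp_hasDerivAt t h1
  exact (hasDerivAt_pdt hf t x).unique h2

theorem contDiff_pdt {f : ℝ → ℝ → ℝ} (hf : ContDiff ℝ (⊤ : ℕ∞) (Function.uncurry f)) :
    ContDiff ℝ (⊤ : ℕ∞) (Function.uncurry (pdt f)) := by
  have h : Function.uncurry (pdt f) = fun p => fderiv ℝ (Function.uncurry f) p (1, 0) :=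
    funext fun p => pdt_eq_fderiv hf p.1 p.2
  rw [h]
  exact (hf.fderiv_right (by simp)).clm_apply contDiff_const

theorem hasDerivAt_intervalIntegral_of_contDiff {f : ℝ → ℝ → ℝ}
    (hf : ContDiff ℝ (⊤ : ℕ∞) (Function.uncurry f)) (a b t : ℝ) :
    HasDerivAt (fun s => ∫ x in a..b, f s x) (∫ x in a..b, pdt f t x) t := by
  have hf1 : ContDiff ℝ 1 (Function.uncurry f) := hf.of_le (by exact_mod_cast le_top)
  have h := (hasFDerivAt_intervalIntegral_of_contDiff hf1 a b t).hasDerivAt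
  refine h.congr_deriv ?_
  have hcont : Continuous fun x : ℝ => (fderiv ℝ (Function.uncurry f) (t, x)).comp
      (ContinuousLinearMap.inl ℝ ℝ ℝ) :=
    ((hf1.continuous_fderiv one_ne_zero).comp
      (by fun_prop : Continuous fun s : ℝ => (t, s))).clm_comp continuous_const
  rw [ContinuousLinearMap.intervalIntegral_apply (hcont.intervalIntegrable _ _)]
  exact intervalIntegral.integral_congr fun x _ => (pdt_eq_fderiv hf t x).symm

/-- Division of a smooth function by `(L - x)²` at every time at which it vanishes to second
order at `x = L`. -/
theorem exists_smooth_factor {u : ℝ → ℝ → ℝ} (hu : ContDiff ℝ (⊤ : ℕ∞) (Function.uncurry u))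
    (L : ℝ) : ∃ v : ℝ → ℝ → ℝ, ContDiff ℝ (⊤ : ℕ∞) (Function.uncurry v) ∧
      ∀ t, u t L = 0 → pdx u t L = 0 → ∀ x, u t x = (L - x) ^ 2 * v t x := by
  have hu1 := contDiff_pdx hu
  have hu2 := contDiff_pdx hu1
  refine ⟨fun t x => ∫ s in (0:ℝ)..1, (1 - s) * pdx (pdx u) t (L + s * (x - L)), ?_, ?_⟩
  · refine ContDiff.parametric_intervalIntegral 0 1
      (f := fun q : (ℝ × ℝ) × ℝ => (1 - q.2) * pdx (pdx u) q.1.1 (L + q.2 * (q.1.2 - L))) ?_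
    have h2 : ContDiff ℝ (⊤ : ℕ∞) fun q : (ℝ × ℝ) × ℝ =>
        pdx (pdx u) q.1.1 (L + q.2 * (q.1.2 - L)) :=
      hu2.comp (f := fun q : (ℝ × ℝ) × ℝ => (q.1.1, L + q.2 * (q.1.2 - L))) (by fun_prop)
    fun_prop
  · intro t h0 h1 x
    have hlin : ∀ s : ℝ, HasDerivAt (fun s : ℝ => L + s * (x - L)) (x - L) s := fun s => by
      simpa using ((hasDerivAt_id s).mul_const (x - L)).const_add L
    have hd : ∀ s ∈ uIcc (0:ℝ) 1, HasDerivAt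
        (fun s => (1 - s) * ((x - L) * pdx u t (L + s * (x - L))) + u t (L + s * (x - L)))
        ((x - L) ^ 2 * ((1 - s) * pdx (pdx u) t (L + s * (x - L)))) s := fun s _ => by
      have hs := (hasDerivAt_id s).const_sub 1
      have e1 := ((hasDerivAt_pdx hu1 t (L + s * (x - L))).comp s (hlin s)).const_mul (x - L)
      have e0 := (hasDerivAt_pdx hu t (L + s * (x - L))).comp s (hlin s)
      refine ((hs.mul e1).add e0).congr_deriv ?_
      simp only [Function.comp_apply, id_eq]
      ring
    have hc : Continuous fun s : ℝ =>
        (x - L) ^ 2 * ((1 - s) * pdx (pdx u) t (L + s * (x - L))) := by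
      have : Continuous fun s : ℝ => pdx (pdx u) t (L + s * (x - L)) :=
        hu2.continuous.comp (f := fun s : ℝ => (t, L + s * (x - L))) (by fun_prop)
      fun_prop
    have key := intervalIntegral.integral_eq_sub_of_hasDerivAt hd (hc.intervalIntegrable _ _)
    rw [intervalIntegral.integral_const_mul] at key
    simp only [sub_self, zero_mul, one_mul, add_sub_cancel, sub_zero, add_zero, zero_add, h0, h1,
      mul_zero] at key
    rw [← key]
    ring
/-- The energy estimate at a fixed time, for `u = (L - x)² V` and `u_x = (L - x) P`. -/
theorem weighted_energy_dissipation {L : ℝ} (hL : 0 < L) {V V₁ V₂ V₃ Vt g g₁ : ℝ → ℝ}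
    (hV : ∀ x, HasDerivAt V (V₁ x) x) (hV₁ : ∀ x, HasDerivAt V₁ (V₂ x) x)
    (hV₂ : ∀ x, HasDerivAt V₂ (V₃ x) x) (hV₃ : Continuous V₃) (hVt : Continuous Vt)
    (hg : ∀ x, HasDerivAt g (g₁ x) x) (hg₁ : Continuous g₁) (hV0 : V 0 = 0)
    (heq : ∀ x ∈ Ioo 0 L, (L - x) ^ 2 * Vt x
      + ((L - x) ^ 2 * V₁ x - 2 * (L - x) * V x)
      + ((L - x) ^ 2 * V₃ x - 6 * (L - x) * V₂ x + 6 * V₁ x) = g₁ x) :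
    ∫ x in (0:ℝ)..L, 2 * (L - x) ^ 3 * V x * Vt x ≤
      -(1 / 10) * (∫ x in (0:ℝ)..L, ((L - x) * V₁ x - 2 * V x) ^ 2)
      + 2 * (∫ x in (0:ℝ)..L, (L - x) ^ 3 * V x ^ 2) + 36 * ∫ x in (0:ℝ)..L, g x ^ 2 := by
  have cV : Continuous V := continuous_iff_continuousAt.2 fun x => (hV x).continuousAt
  have cV₁ : Continuous V₁ := continuous_iff_continuousAt.2 fun x => (hV₁ x).continuousAt
  have cV₂ : Continuous V₂ := continuous_iff_continuousAt.2 fun x => (hV₂ x).continuousAt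
  have cg : Continuous g := continuous_iff_continuousAt.2 fun x => (hg x).continuousAt
  set B : ℝ → ℝ := fun x => 2 * (L - x) * V x * g x - (L - x) ^ 3 * V x ^ 2
    - (2 * (L - x) * V x * ((L - x) ^ 2 * V₂ x - 4 * (L - x) * V₁ x + 2 * V x)
      - (L - x) * ((L - x) * V₁ x - 2 * V x) ^ 2
      - 2 * (L - x) * V x * ((L - x) * V₁ x - 2 * V x) + 2 * (L - x) * V x ^ 2)
    + 38 / 9 * ((L - x) * V x ^ 2) with hB
  set B' : ℝ → ℝ := fun x =>
    2 * (L - x) * V x * (g₁ x - ((L - x) ^ 2 * V₁ x - 2 * (L - x) * V x)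
      - ((L - x) ^ 2 * V₃ x - 6 * (L - x) * V₂ x + 6 * V₁ x))
    - (-3 * ((L - x) * V₁ x - 2 * V x) ^ 2 + 6 * V x ^ 2 + (L - x) ^ 2 * V x ^ 2
      - 2 * ((L - x) * V₁ x - V x) * g x)
    + 38 / 9 * (2 * (L - x) * V x * V₁ x - V x ^ 2) with hB'
  have hd : ∀ x, HasDerivAt B (B' x) x := fun x => by
    have y : HasDerivAt (fun x => L - x) (-1) x := (hasDerivAt_id x).const_sub L
    have v := hV x
    have v1 := hV₁ x
    have v2 := hV₂ x
    have p := (y.mul v1).sub (v.const_mul 2)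
    have w := (y.const_mul 2).mul v
    refine (((((w.mul (hg x)).sub ((y.pow 3).mul (v.pow 2))).sub
      ((((w.mul ((((y.pow 2).mul v2).sub ((y.const_mul 4).mul v1)).add (v.const_mul 2))).sub
        (y.mul (p.pow 2))).sub (w.mul p)).add ((y.const_mul 2).mul (v.pow 2)))).add
      ((y.mul (v.pow 2)).const_mul (38 / 9)))).congr_deriv ?_
    simp only [hB', Pi.mul_apply, Pi.sub_apply, Pi.add_apply, Pi.pow_apply]
    push_cast
    ring
  have cB' : Continuous B' := by fun_prop
  have hFTC : ∫ x in (0:ℝ)..L, B' x = B L - B 0 :=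
    intervalIntegral.integral_eq_sub_of_hasDerivAt (fun x _ => hd x) (cB'.intervalIntegrable _ _)
  have hbdry : B L - B 0 ≤ 0 := by
    have : B L - B 0 = -(L * (L * V₁ 0) ^ 2) := by
      simp only [hB, hV0]
      ring
    rw [this]
    exact neg_nonpos.2 (by positivity)
  have hmono : ∫ x in (0:ℝ)..L, 2 * (L - x) ^ 3 * V x * Vt x ≤
      ∫ x in (0:ℝ)..L, (B' x + (-(1 / 10) * ((L - x) * V₁ x - 2 * V x) ^ 2
        + 2 * ((L - x) ^ 3 * V x ^ 2) + 36 * g x ^ 2)) := by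
    refine intervalIntegral.integral_mono_on_of_le_Ioo hL.le
      ((by fun_prop : Continuous _).intervalIntegrable _ _)
      ((by fun_prop : Continuous _).intervalIntegrable _ _) fun x hx => ?_
    have hy : 0 < L - x := sub_pos.2 hx.2
    have e := heq x hx
    have hLHS : 2 * (L - x) ^ 3 * V x * Vt x = 2 * (L - x) * V x *
        (g₁ x - ((L - x) ^ 2 * V₁ x - 2 * (L - x) * V x)
          - ((L - x) ^ 2 * V₃ x - 6 * (L - x) * V₂ x + 6 * V₁ x)) := by
      rw [← e]
      ring
    have hyy : (L - x) ^ 2 ≤ 1 / 4 + 2 * (L - x) ^ 3 := by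
      rcases le_total (L - x) (1 / 2) with h | h
      · nlinarith [pow_pos hy 3]
      · nlinarith [pow_pos hy 2]
    have hyV := mul_le_mul_of_nonneg_right hyy (sq_nonneg (V x))
    rw [hLHS]
    simp only [hB']
    generalize hP : (L - x) * V₁ x - 2 * V x = P
    have hyV₁ : (L - x) * V₁ x = P + 2 * V x := by rw [← hP]; ring
    have h1 : 2 * (L - x) * V x * V₁ x = 2 * V x * (P + 2 * V x) := by rw [← hyV₁]; ring
    rw [h1, hyV₁]
    nlinarith [sq_nonneg (P + 3 / 2 * V x), sq_nonneg ((P + V x) + 36 * g x),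
      sq_nonneg (P - V x), sq_nonneg P, sq_nonneg (V x)]
  refine hmono.trans ?_
  rw [intervalIntegral.integral_add (f := B') (cB'.intervalIntegrable _ _)
      ((by fun_prop : Continuous _).intervalIntegrable _ _), hFTC,
    intervalIntegral.integral_add ((by fun_prop : Continuous _).intervalIntegrable _ _)
      ((by fun_prop : Continuous _).intervalIntegrable _ _),
    intervalIntegral.integral_add ((by fun_prop : Continuous _).intervalIntegrable _ _)
      ((by fun_prop : Continuous _).intervalIntegrable _ _),
    intervalIntegral.integral_const_mul, intervalIntegral.integral_const_mul,
    intervalIntegral.integral_const_mul]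
  linarith

/-- A Grönwall-type bound for an energy `E` with dissipation `D` and forcing `K * H`. -/
theorem energy_add_dissipation_le {T K : ℝ} (hT : 0 < T) (hK : 0 ≤ K) {E E' D H : ℝ → ℝ}
    (hE : ∀ t, HasDerivAt E (E' t) t) (hD : Continuous D) (hH : Continuous H)
    (hE0 : ∀ t, 0 ≤ E t) (hD0 : ∀ t, 0 ≤ D t) (hH0 : ∀ t, 0 ≤ H t)
    (hineq : ∀ t ∈ Ioo 0 T, E' t ≤ -(1 / 10) * D t + 2 * E t + K * H t) :
    ∀ t ∈ Icc 0 T, E t + (∫ τ in (0:ℝ)..T, D τ) ≤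
      11 * Real.exp (2 * T) * (1 + K) * (E 0 + ∫ τ in (0:ℝ)..T, H τ) := by
  set A := Real.exp (-(2 * T))
  have hA : 0 < A := Real.exp_pos _
  set w : ℝ → ℝ := fun τ => A / 10 * D τ - K * H τ with hw
  have cw : Continuous w := by fun_prop
  set G : ℝ → ℝ := fun t => Real.exp (-(2 * t)) * E t + ∫ τ in (0:ℝ)..t, w τ with hG
  have hexp : ∀ t, HasDerivAt (fun t => Real.exp (-(2 * t))) (-2 * Real.exp (-(2 * t))) t :=
    fun t => by
      have h : HasDerivAt (fun t : ℝ => -(2 * t)) (-2) t := by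
        exact ((hasDerivAt_id t).const_mul 2).neg.congr_deriv (by simp)
      exact h.exp.congr_deriv (by ring)
  have hGd : ∀ t, HasDerivAt G
      (-2 * Real.exp (-(2 * t)) * E t + Real.exp (-(2 * t)) * E' t + w t) t := fun t =>
    ((hexp t).mul (hE t)).add (intervalIntegral.integral_hasDerivAt_right
      (cw.intervalIntegrable _ _) (cw.stronglyMeasurableAtFilter _ _) cw.continuousAt)
  have hanti : AntitoneOn G (Icc 0 T) := by
    refine antitoneOn_of_deriv_nonpos (convex_Icc 0 T)
      (fun t _ => (hGd t).continuousAt.continuousWithinAt)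
      (fun t _ => (hGd t).differentiableAt.differentiableWithinAt) fun t ht => ?_
    rw [interior_Icc] at ht
    rw [(hGd t).deriv]
    have h1 := mul_le_mul_of_nonneg_left (hineq t ht) (Real.exp_pos (-(2 * t))).le
    have h2 : A ≤ Real.exp (-(2 * t)) := Real.exp_le_exp.2 (by linarith [ht.2])
    have h3 : Real.exp (-(2 * t)) ≤ 1 := Real.exp_le_one_iff.2 (by linarith [ht.1])
    have h4 := mul_le_mul_of_nonneg_right h2 (hD0 t)
    have h5 := mul_le_mul_of_nonneg_right h3 (mul_nonneg hK (hH0 t))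
    simp only [hw]
    linarith
  have hG0 : G 0 = E 0 := by simp [hG]
  have hwint : ∀ t, ∫ τ in (0:ℝ)..t, w τ
      = A / 10 * (∫ τ in (0:ℝ)..t, D τ) - K * ∫ τ in (0:ℝ)..t, H τ := fun t => by
    rw [← intervalIntegral.integral_const_mul, ← intervalIntegral.integral_const_mul,
      ← intervalIntegral.integral_sub ((by fun_prop : Continuous _).intervalIntegrable _ _)
      ((by fun_prop : Continuous _).intervalIntegrable _ _)]
  have hzero : (0:ℝ) ∈ Icc 0 T := ⟨le_rfl, hT.le⟩
  have hH0T : 0 ≤ ∫ τ in (0:ℝ)..T, H τ :=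
    intervalIntegral.integral_nonneg hT.le fun τ _ => hH0 τ
  have hAinv : A * Real.exp (2 * T) = 1 := by rw [← Real.exp_add]; simp
  intro t ht
  have ht1 := hanti hzero ht ht.1
  have hT1 := hanti hzero ⟨hT.le, le_rfl⟩ hT.le
  rw [hG0] at ht1 hT1
  simp only [hG, hwint] at ht1 hT1
  have hDt : 0 ≤ ∫ τ in (0:ℝ)..t, D τ :=
    intervalIntegral.integral_nonneg ht.1 fun τ _ => hD0 τ
  have hHt : ∫ τ in (0:ℝ)..t, H τ ≤ ∫ τ in (0:ℝ)..T, H τ :=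
    intervalIntegral.integral_mono_interval le_rfl ht.1 ht.2 (.of_forall hH0)
      (hH.intervalIntegrable _ _)
  have hAt : A * E t ≤ Real.exp (-(2 * t)) * E t :=
    mul_le_mul_of_nonneg_right (Real.exp_le_exp.2 (by linarith [ht.2])) (hE0 t)
  have hAT : 0 ≤ A * E T := mul_nonneg hA.le (hE0 T)
  have hKH := mul_le_mul_of_nonneg_left hHt hK
  have hAD := mul_nonneg hA.le hDt
  set I := ∫ τ in (0:ℝ)..T, H τ
  set J := ∫ τ in (0:ℝ)..T, D τ
  have hsum : A * (E t + J) ≤ 11 * (E 0 + K * I) := by linarith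
  have hsum' : A * (E t + J) ≤ 11 * ((1 + K) * (E 0 + I)) := by
    linarith [mul_nonneg hK (hE0 0)]
  calc E t + J = Real.exp (2 * T) * (A * (E t + J)) := by
        rw [← mul_assoc, mul_comm (Real.exp _), hAinv, one_mul]
    _ ≤ Real.exp (2 * T) * (11 * ((1 + K) * (E 0 + I))) :=
        mul_le_mul_of_nonneg_left hsum' (Real.exp_pos _).le
    _ = _ := by ring

/-- a priori estimate for linear KdV with localized derivative
forcing `(ρ(x)h)_x` in the weighted space with weight `1/(L−x)`:
`max_{t∈[0,T]} ∫ u(t)²/(L−x) dx + ∫∫ u_x²/(L−x)² ≤ C (∫ u(0)²/(L−x) dx + ∫∫ h²)`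
(the max over `t` is expressed as a bound for every `t ∈ [0,T]`). -/
theorem stmt_16 (L T ν : ℝ) (hL : 0 < L) (hT : 0 < T) (hν0 : 0 < ν) (hνL : ν < L)
    (ρ : ℝ → ℝ) (hρ : ContDiff ℝ (⊤ : ℕ∞) ρ)
    (hρ0 : ∀ x ∈ Set.Icc (0:ℝ) (L - ν), ρ x = 0)
    (hρ1 : ∀ x ∈ Set.Icc (L - ν / 2) L, ρ x = 1) :
    ∃ C : ℝ, 0 < C ∧
      ∀ h u : ℝ → ℝ → ℝ, ContDiff ℝ (⊤ : ℕ∞) (Function.uncurry h) →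
        ContDiff ℝ (⊤ : ℕ∞) (Function.uncurry u) →
        (∀ t ∈ Set.Ioo (0:ℝ) T, ∀ x ∈ Set.Ioo (0:ℝ) L,
          pdt u t x + pdx u t x + pdx (pdx (pdx u)) t x
            = pdx (fun t x => ρ x * h t x) t x) →
        (∀ t ∈ Set.Icc (0:ℝ) T, u t 0 = 0 ∧ u t L = 0 ∧ pdx u t L = 0) →
        ∀ t ∈ Set.Icc (0:ℝ) T,
          (∫ x in (0:ℝ)..L, (u t x) ^ 2 / (L - x))
            + (∫ τ in (0:ℝ)..T, ∫ x in (0:ℝ)..L, (pdx u τ x) ^ 2 / (L - x) ^ 2) ≤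
          C * ((∫ x in (0:ℝ)..L, (u 0 x) ^ 2 / (L - x))
            + ∫ τ in (0:ℝ)..T, ∫ x in (0:ℝ)..L, (h τ x) ^ 2) := by
  obtain ⟨R, hR⟩ := (isCompact_Icc (a := (0:ℝ)) (b := L)).exists_bound_of_continuousOn
    hρ.continuous.continuousOn
  refine ⟨11 * Real.exp (2 * T) * (1 + 36 * R ^ 2), by positivity, fun h u hh hu hpde hbc => ?_⟩
  obtain ⟨v, hv, huv⟩ := exists_smooth_factor hu L
  have hfac : ∀ t ∈ Icc 0 T, ∀ x, u t x = (L - x) ^ 2 * v t x := fun t ht =>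
    huv t (hbc t ht).2.1 (hbc t ht).2.2
  have hv1 := contDiff_pdx hv
  have hv2 := contDiff_pdx hv1
  have hv3 := contDiff_pdx hv2
  have hvt := contDiff_pdt hv
  have slice : ∀ {f : ℝ → ℝ → ℝ}, ContDiff ℝ (⊤ : ℕ∞) (Function.uncurry f) →
      ∀ t, Continuous (f t) := fun {f} hf t =>
    hf.continuous.comp (f := fun x : ℝ => (t, x)) (by fun_prop)
  have hy : ∀ x, HasDerivAt (fun x => L - x) (-1) x := fun x => (hasDerivAt_id x).const_sub L
  have hux : ∀ t ∈ Icc 0 T, ∀ x,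
      pdx u t x = (L - x) ^ 2 * pdx v t x - 2 * (L - x) * v t x := fun t ht x => by
    have e : u t = fun x => (L - x) ^ 2 * v t x := funext (hfac t ht)
    have d := ((hy x).pow 2).mul (hasDerivAt_pdx hv t x)
    refine (hasDerivAt_pdx hu t x).unique ?_
    rw [e]
    refine d.congr_deriv ?_
    simp only [Pi.pow_apply]
    push_cast
    ring
  have huxx : ∀ t ∈ Icc 0 T, ∀ x, pdx (pdx u) t x =
      (L - x) ^ 2 * pdx (pdx v) t x - 4 * (L - x) * pdx v t x + 2 * v t x := fun t ht x => by
    have e : pdx u t = fun x => (L - x) ^ 2 * pdx v t x - 2 * (L - x) * v t x :=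
      funext (hux t ht)
    have d := (((hy x).pow 2).mul (hasDerivAt_pdx hv1 t x)).sub
      (((hy x).const_mul 2).mul (hasDerivAt_pdx hv t x))
    refine (hasDerivAt_pdx (contDiff_pdx hu) t x).unique ?_
    rw [e]
    refine d.congr_deriv ?_
    simp only [Pi.pow_apply]
    push_cast
    ring
  have huxxx : ∀ t ∈ Icc 0 T, ∀ x, pdx (pdx (pdx u)) t x =
      (L - x) ^ 2 * pdx (pdx (pdx v)) t x - 6 * (L - x) * pdx (pdx v) t x
        + 6 * pdx v t x := fun t ht x => by
    have e : pdx (pdx u) t = fun x =>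
        (L - x) ^ 2 * pdx (pdx v) t x - 4 * (L - x) * pdx v t x + 2 * v t x :=
      funext (huxx t ht)
    have d := ((((hy x).pow 2).mul (hasDerivAt_pdx hv2 t x)).sub
      (((hy x).const_mul 4).mul (hasDerivAt_pdx hv1 t x))).add
      ((hasDerivAt_pdx hv t x).const_mul 2)
    refine (hasDerivAt_pdx (contDiff_pdx (contDiff_pdx hu)) t x).unique ?_
    rw [e]
    refine d.congr_deriv ?_
    simp only [Pi.pow_apply]
    push_cast
    ring
  have hut : ∀ t ∈ Ioo 0 T, ∀ x, pdt u t x = (L - x) ^ 2 * pdt v t x := fun t ht x => by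
    refine (hasDerivAt_pdt hu t x).unique
      (((hasDerivAt_pdt hv t x).const_mul ((L - x) ^ 2)).congr_of_eventuallyEq ?_)
    filter_upwards [Ioo_mem_nhds ht.1 ht.2] with s hs
    exact hfac s (Ioo_subset_Icc_self hs) x
  -- the three functionals, written with the smooth factor
  have hF : ContDiff ℝ (⊤ : ℕ∞) (Function.uncurry fun t x => (L - x) ^ 3 * v t x ^ 2) :=
    (by fun_prop : ContDiff ℝ (⊤ : ℕ∞) fun p : ℝ × ℝ => (L - p.2) ^ 3).mul (hv.pow 2)
  have hP : ContDiff ℝ (⊤ : ℕ∞)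
      (Function.uncurry fun t x => ((L - x) * pdx v t x - 2 * v t x) ^ 2) :=
    (((by fun_prop : ContDiff ℝ (⊤ : ℕ∞) fun p : ℝ × ℝ => L - p.2).mul hv1).sub
      ((contDiff_const (c := (2:ℝ))).mul hv)).pow 2
  have hFt : ∀ t x, pdt (fun t x => (L - x) ^ 3 * v t x ^ 2) t x
      = 2 * (L - x) ^ 3 * v t x * pdt v t x := fun t x => by
    refine (hasDerivAt_pdt hF t x).unique ?_
    refine (((hasDerivAt_pdt hv t x).pow 2).const_mul ((L - x) ^ 3)).congr_deriv ?_
    push_cast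
    ring
  have hEd : ∀ t, HasDerivAt (fun t => ∫ x in (0:ℝ)..L, (L - x) ^ 3 * v t x ^ 2)
      (∫ x in (0:ℝ)..L, 2 * (L - x) ^ 3 * v t x * pdt v t x) t := fun t => by
    have := hasDerivAt_intervalIntegral_of_contDiff hF 0 L t
    simpa only [hFt] using this
  have hDc : Continuous fun t => ∫ x in (0:ℝ)..L, ((L - x) * pdx v t x - 2 * v t x) ^ 2 :=
    intervalIntegral.continuous_parametric_intervalIntegral_of_continuous' hP.continuous 0 L
  have hh2 : ContDiff ℝ (⊤ : ℕ∞) (Function.uncurry fun t x => h t x ^ 2) := hh.pow 2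
  have hHc : Continuous fun t => ∫ x in (0:ℝ)..L, h t x ^ 2 :=
    intervalIntegral.continuous_parametric_intervalIntegral_of_continuous'
      (f := fun t x => h t x ^ 2) hh2.continuous 0 L
  have hg : ContDiff ℝ (⊤ : ℕ∞) (Function.uncurry fun t x => ρ x * h t x) :=
    (hρ.comp contDiff_snd).mul hh
  have hineq : ∀ t ∈ Ioo 0 T, ∫ x in (0:ℝ)..L, 2 * (L - x) ^ 3 * v t x * pdt v t x ≤
      -(1 / 10) * (∫ x in (0:ℝ)..L, ((L - x) * pdx v t x - 2 * v t x) ^ 2)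
      + 2 * (∫ x in (0:ℝ)..L, (L - x) ^ 3 * v t x ^ 2)
      + 36 * R ^ 2 * ∫ x in (0:ℝ)..L, h t x ^ 2 := fun t ht => by
    have htc := Ioo_subset_Icc_self ht
    have hv0 : v t 0 = 0 := by
      have e := hfac t htc 0
      rw [(hbc t htc).1, sub_zero] at e
      exact (mul_eq_zero.1 e.symm).resolve_left (by positivity)
    have key := weighted_energy_dissipation hL (hasDerivAt_pdx hv t) (hasDerivAt_pdx hv1 t)
      (hasDerivAt_pdx hv2 t) (slice hv3 t) (slice hvt t) (hasDerivAt_pdx hg t)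
      (slice (contDiff_pdx hg) t) hv0 fun x hx => by
        rw [← hux t htc, ← huxxx t htc, ← hut t ht]
        exact hpde t ht x hx
    have hgle : ∫ x in (0:ℝ)..L, (ρ x * h t x) ^ 2 ≤ R ^ 2 * ∫ x in (0:ℝ)..L, h t x ^ 2 := by
      rw [← intervalIntegral.integral_const_mul]
      have ch := slice hh t
      refine intervalIntegral.integral_mono_on hL.le (((slice hg t).pow 2).intervalIntegrable _ _)
        ((by fun_prop : Continuous _).intervalIntegrable _ _) fun x hx => ?_
      rw [mul_pow]
      exact mul_le_mul_of_nonneg_right (sq_le_sq.2 ((hR x hx).trans (le_abs_self R)))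
        (sq_nonneg _)
    linarith
  have main := energy_add_dissipation_le hT (by positivity : 0 ≤ 36 * R ^ 2) hEd hDc hHc
    (fun t => intervalIntegral.integral_nonneg hL.le fun x hx =>
      mul_nonneg (pow_nonneg (sub_nonneg.2 hx.2) 3) (sq_nonneg _))
    (fun t => intervalIntegral.integral_nonneg hL.le fun x _ => sq_nonneg _)
    (fun t => intervalIntegral.integral_nonneg hL.le fun x _ => sq_nonneg _) hineq
  have hEeq : ∀ t ∈ Icc 0 T, ∫ x in (0:ℝ)..L, (u t x) ^ 2 / (L - x)
      = ∫ x in (0:ℝ)..L, (L - x) ^ 3 * v t x ^ 2 := fun t ht => by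
    refine intervalIntegral.integral_congr fun x _ => ?_
    simp only [hfac t ht x]
    rcases eq_or_ne (L - x) 0 with h0 | h0
    · simp [h0]
    · field_simp
  have hDeq : ∀ t ∈ Icc 0 T, ∫ x in (0:ℝ)..L, (pdx u t x) ^ 2 / (L - x) ^ 2
      = ∫ x in (0:ℝ)..L, ((L - x) * pdx v t x - 2 * v t x) ^ 2 := fun t ht => by
    refine intervalIntegral.integral_congr_Ioo_of_le hL.le fun x hx => ?_
    have h0 : L - x ≠ 0 := (sub_pos.2 hx.2).ne'
    simp only [hux t ht x]
    field_simp
  intro t ht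
  rw [hEeq t ht, hEeq 0 ⟨le_rfl, hT.le⟩, intervalIntegral.integral_congr (f := fun τ =>
    ∫ x in (0:ℝ)..L, (pdx u τ x) ^ 2 / (L - x) ^ 2) fun τ hτ => hDeq τ (uIcc_of_le hT.le ▸ hτ)]
  exact main t ht
end

section
/- (Observability inequality for the linear KdV equation in the weighted space L²_{x dx}.) Let L, T > 0 and 0 < ν < L. There exists a constant C > 0 such that for every w ∈ C^∞([0,T]×[0,L]) satisfying w_t + w_x + w_xxx = 0 on (0,T)×(0,L) and w(t,0) = w(t,L) = w_x(t,L) = 0 for all t ∈ [0,T], one has: ∫₀^L x · w(0,x)² dx ≤ C ∫₀^T ∫₀^{ν/2} w_x(t,x)² dx dt. -/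
open MeasureTheory Set

namespace KdV

/-- Iterated integral over the rectangle `[0, T] × [0, L]`. -/
noncomputable def dInt (T L : ℝ) (F : ℝ → ℝ → ℝ) : ℝ :=
  ∫ t in (0:ℝ)..T, ∫ x in (0:ℝ)..L, F t x

theorem continuous_integral_right {F : ℝ → ℝ → ℝ} (hF : Continuous fun p : ℝ × ℝ => F p.1 p.2)
    (a b : ℝ) : Continuous fun t => ∫ x in a..b, F t x :=
  intervalIntegral.continuous_parametric_intervalIntegral_of_continuous' hF a b

theorem dInt_mono {T L : ℝ} (hT : 0 ≤ T) (hL : 0 ≤ L) {F G : ℝ → ℝ → ℝ}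
    (hF : Continuous fun p : ℝ × ℝ => F p.1 p.2) (hG : Continuous fun p : ℝ × ℝ => G p.1 p.2)
    (h : ∀ t ∈ Icc 0 T, ∀ x ∈ Icc 0 L, F t x ≤ G t x) : dInt T L F ≤ dInt T L G := by
  refine intervalIntegral.integral_mono_on hT
    ((continuous_integral_right hF 0 L).intervalIntegrable _ _)
    ((continuous_integral_right hG 0 L).intervalIntegrable _ _) fun t ht => ?_
  have h1 : Continuous (F t) := by fun_prop
  have h2 : Continuous (G t) := by fun_prop
  exact intervalIntegral.integral_mono_on hL (h1.intervalIntegrable _ _)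
    (h2.intervalIntegrable _ _) (h t ht)

theorem dInt_nonneg {T L : ℝ} (hT : 0 ≤ T) (hL : 0 ≤ L) {F : ℝ → ℝ → ℝ}
    (h : ∀ t ∈ Icc 0 T, ∀ x ∈ Icc 0 L, 0 ≤ F t x) : 0 ≤ dInt T L F :=
  intervalIntegral.integral_nonneg hT fun t ht =>
    intervalIntegral.integral_nonneg hL fun x hx => h t ht x hx

theorem dInt_add (T L : ℝ) {F G : ℝ → ℝ → ℝ}
    (hF : Continuous fun p : ℝ × ℝ => F p.1 p.2) (hG : Continuous fun p : ℝ × ℝ => G p.1 p.2) :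
    dInt T L (fun t x => F t x + G t x) = dInt T L F + dInt T L G := by
  unfold dInt
  rw [← intervalIntegral.integral_add
    ((continuous_integral_right hF 0 L).intervalIntegrable _ _)
    ((continuous_integral_right hG 0 L).intervalIntegrable _ _)]
  congr 1
  ext t
  have h1 : Continuous (F t) := by fun_prop
  have h2 : Continuous (G t) := by fun_prop
  exact intervalIntegral.integral_add (h1.intervalIntegrable _ _) (h2.intervalIntegrable _ _)

theorem dInt_const_mul (T L c : ℝ) (F : ℝ → ℝ → ℝ) :
    dInt T L (fun t x => c * F t x) = c * dInt T L F := by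
  simp [dInt]

theorem dInt_mono_right {T m L : ℝ} (hT : 0 ≤ T) (hm : 0 ≤ m) (hmL : m ≤ L) {F : ℝ → ℝ → ℝ}
    (hF : Continuous fun p : ℝ × ℝ => F p.1 p.2)
    (h : ∀ t ∈ Icc 0 T, ∀ x ∈ Icc 0 L, 0 ≤ F t x) : dInt T m F ≤ dInt T L F := by
  refine intervalIntegral.integral_mono_on hT
    ((continuous_integral_right hF 0 m).intervalIntegrable _ _)
    ((continuous_integral_right hF 0 L).intervalIntegrable _ _) fun t ht => ?_
  have h1 : Continuous (F t) := by fun_prop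
  rw [← intervalIntegral.integral_add_adjacent_intervals (h1.intervalIntegrable 0 m)
    (h1.intervalIntegrable m L)]
  have : 0 ≤ ∫ x in m..L, F t x :=
    intervalIntegral.integral_nonneg hmL fun x hx => h t ht x ⟨hm.trans hx.1, hx.2⟩
  linarith

/-- Comparison of integrals when the pointwise bound needs an extra term on `[0, m]`. -/
theorem dInt_le_add_of_le {T m L : ℝ} (hT : 0 ≤ T) (hm : 0 ≤ m) (hmL : m ≤ L)
    {F G H : ℝ → ℝ → ℝ} (hF : Continuous fun p : ℝ × ℝ => F p.1 p.2)
    (hG : Continuous fun p : ℝ × ℝ => G p.1 p.2) (hH : Continuous fun p : ℝ × ℝ => H p.1 p.2)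
    (h1 : ∀ t ∈ Icc 0 T, ∀ x ∈ Icc 0 m, F t x ≤ G t x + H t x)
    (h2 : ∀ t ∈ Icc 0 T, ∀ x ∈ Icc m L, F t x ≤ G t x) :
    dInt T L F ≤ dInt T L G + dInt T m H := by
  unfold dInt
  rw [← intervalIntegral.integral_add
    ((continuous_integral_right hG 0 L).intervalIntegrable _ _)
    ((continuous_integral_right hH 0 m).intervalIntegrable _ _)]
  refine intervalIntegral.integral_mono_on hT
    ((continuous_integral_right hF 0 L).intervalIntegrable _ _)
    (((continuous_integral_right hG 0 L).add (continuous_integral_right hH 0 m)).intervalIntegrable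
      _ _) fun t ht => ?_
  have cF : Continuous (F t) := by fun_prop
  have cG : Continuous (G t) := by fun_prop
  have cH : Continuous (H t) := by fun_prop
  rw [← intervalIntegral.integral_add_adjacent_intervals (cF.intervalIntegrable 0 m)
    (cF.intervalIntegrable m L), ← intervalIntegral.integral_add_adjacent_intervals
    (cG.intervalIntegrable 0 m) (cG.intervalIntegrable m L)]
  have e1 : ∫ x in (0:ℝ)..m, F t x ≤ ∫ x in (0:ℝ)..m, (G t x + H t x) :=
    intervalIntegral.integral_mono_on hm (cF.intervalIntegrable _ _)
      ((cG.add cH).intervalIntegrable _ _) (h1 t ht)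
  rw [intervalIntegral.integral_add (cG.intervalIntegrable _ _) (cH.intervalIntegrable _ _)] at e1
  have e2 : ∫ x in m..L, F t x ≤ ∫ x in m..L, G t x :=
    intervalIntegral.integral_mono_on hmL (cF.intervalIntegrable _ _)
      (cG.intervalIntegrable _ _) (h2 t ht)
  linarith

/-- Integrated form of a pointwise inequality `∂ₜ f + ∂ₓ g ≤ H`. -/
theorem integral_sub_le_dInt {T L : ℝ} (hT : 0 ≤ T) (hL : 0 ≤ L) {f ft g gx H : ℝ → ℝ → ℝ}
    (hf : ∀ t x, HasDerivAt (fun s => f s x) (ft t x) t)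
    (hg : ∀ t x, HasDerivAt (g t) (gx t x) x)
    (cft : Continuous fun p : ℝ × ℝ => ft p.1 p.2) (cgx : Continuous fun p : ℝ × ℝ => gx p.1 p.2)
    (cH : Continuous fun p : ℝ × ℝ => H p.1 p.2)
    (hle : ∀ t ∈ Icc 0 T, ∀ x ∈ Icc 0 L, ft t x + gx t x ≤ H t x)
    (hb : ∀ t ∈ Icc 0 T, g t 0 ≤ g t L) :
    ∫ x in (0:ℝ)..L, (f T x - f 0 x) ≤ dInt T L H := by
  have h1 : dInt T L (fun t x => ft t x + gx t x) ≤ dInt T L H :=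
    dInt_mono hT hL (by fun_prop) cH hle
  rw [dInt_add T L cft cgx] at h1
  have h2 : dInt T L ft = ∫ x in (0:ℝ)..L, (f T x - f 0 x) := by
    unfold dInt
    rw [intervalIntegral_intervalIntegral_swap]
    · congr 1
      ext x
      have : Continuous fun t => ft t x := by fun_prop
      exact intervalIntegral.integral_eq_sub_of_hasDerivAt (fun t _ => hf t x)
        (this.intervalIntegrable _ _)
    · have : IntegrableOn (Function.uncurry ft) (uIcc 0 T ×ˢ uIcc 0 L) :=
        cft.continuousOn.integrableOn_compact (isCompact_uIcc.prod isCompact_uIcc)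
      exact this.mono_set (prod_mono uIoc_subset_uIcc uIoc_subset_uIcc)
  have h3 : 0 ≤ dInt T L gx := by
    refine intervalIntegral.integral_nonneg hT fun t ht => ?_
    have : Continuous (gx t) := by fun_prop
    rw [intervalIntegral.integral_eq_sub_of_hasDerivAt (fun x _ => hg t x)
      (this.intervalIntegrable _ _)]
    linarith [hb t ht]
  linarith

/-- Integrated form of a pointwise inequality `∂ₓ g ≤ H`. -/
theorem dInt_nonneg_of_deriv_le {T L : ℝ} (hT : 0 ≤ T) (hL : 0 ≤ L) {g gx H : ℝ → ℝ → ℝ}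
    (hg : ∀ t x, HasDerivAt (g t) (gx t x) x)
    (cgx : Continuous fun p : ℝ × ℝ => gx p.1 p.2) (cH : Continuous fun p : ℝ × ℝ => H p.1 p.2)
    (hle : ∀ t ∈ Icc 0 T, ∀ x ∈ Icc 0 L, gx t x ≤ H t x)
    (hb : ∀ t ∈ Icc 0 T, g t 0 ≤ g t L) : 0 ≤ dInt T L H := by
  have := integral_sub_le_dInt (f := fun _ _ => 0) (ft := fun _ _ => 0) hT hL
    (fun t x => hasDerivAt_const _ _) hg (by fun_prop) cgx cH (by simpa using hle) hb
  simpa using this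

/-- A solution `u` of `uₜ + uₓ + uₓₓₓ = 0` on `[0, T] × [0, L]` with
`u(t, 0) = u(t, L) = uₓ(t, L) = 0`, bundled with the derivatives in the equation. -/
structure IsSolution (T L : ℝ) (u u1 u2 u3 ut : ℝ → ℝ → ℝ) : Prop where
  cont : Continuous fun p : ℝ × ℝ => u p.1 p.2
  cont1 : Continuous fun p : ℝ × ℝ => u1 p.1 p.2
  cont2 : Continuous fun p : ℝ × ℝ => u2 p.1 p.2
  cont3 : Continuous fun p : ℝ × ℝ => u3 p.1 p.2
  contt : Continuous fun p : ℝ × ℝ => ut p.1 p.2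
  dx : ∀ t x, HasDerivAt (u t) (u1 t x) x
  dx1 : ∀ t x, HasDerivAt (u1 t) (u2 t x) x
  dx2 : ∀ t x, HasDerivAt (u2 t) (u3 t x) x
  dt : ∀ t x, HasDerivAt (fun s => u s x) (ut t x) t
  eq : ∀ t ∈ Icc 0 T, ∀ x ∈ Icc 0 L, ut t x = -u1 t x - u3 t x
  left : ∀ t ∈ Icc 0 T, u t 0 = 0
  right : ∀ t ∈ Icc 0 T, u t L = 0
  right1 : ∀ t ∈ Icc 0 T, u1 t L = 0

/-- Energy inequality with weight `x` in space and `k` in time. -/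
theorem IsSolution.weighted_energy {T L : ℝ} (hT : 0 ≤ T) (hL : 0 ≤ L)
    {u u1 u2 u3 ut : ℝ → ℝ → ℝ} (S : IsSolution T L u u1 u2 u3 ut) {k k' : ℝ → ℝ}
    (hk : ∀ t, HasDerivAt k (k' t) t) (ck' : Continuous k') (hk0 : ∀ t ∈ Icc 0 T, 0 ≤ k t) :
    ∫ x in (0:ℝ)..L, (k T * (x * u T x ^ 2) - k 0 * (x * u 0 x ^ 2)) ≤
      dInt T L fun t x => k' t * (x * u t x ^ 2) +
        k t * (L * (x * u t x ^ 2) - 2 * u1 t x ^ 2) := by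
  have ⟨c, c1, c2, c3, ct, dx, dx1, dx2, dt, eq, l, r, r1⟩ := S
  have ck : Continuous k := continuous_iff_continuousAt.2 fun t => (hk t).continuousAt
  refine integral_sub_le_dInt hT hL (f := fun t x => k t * (x * u t x ^ 2))
    (ft := fun t x => k' t * (x * u t x ^ 2) + k t * (x * (2 * u t x * ut t x)))
    (g := fun t x => k t * (2 * x * u t x * u2 t x - 2 * u t x * u1 t x - x * u1 t x ^ 2))
    (gx := fun t x => k t * (2 * x * u t x * u3 t x - 3 * u1 t x ^ 2)) ?_ ?_ (by fun_prop)
    (by fun_prop) (by fun_prop) ?_ ?_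
  · intro t x
    refine ((hk t).fun_mul (((dt t x).fun_pow 2).const_mul x)).congr_deriv ?_
    simp
  · intro t x
    refine (((((((hasDerivAt_id' x).const_mul 2).fun_mul (dx t x)).fun_mul (dx2 t x)).fun_sub
      (((dx t x).const_mul 2).fun_mul (dx1 t x))).fun_sub
      ((hasDerivAt_id' x).fun_mul ((dx1 t x).fun_pow 2))).const_mul (k t)).congr_deriv ?_
    push_cast
    ring
  · intro t ht x hx
    rw [eq t ht x hx]
    have h1 : x * (x * u t x ^ 2) ≤ L * (x * u t x ^ 2) :=
      mul_le_mul_of_nonneg_right hx.2 (mul_nonneg hx.1 (sq_nonneg _))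
    have h2 : 0 ≤ k t * (L * (x * u t x ^ 2) - x * (x * u t x ^ 2) + (x * u t x + u1 t x) ^ 2) :=
      mul_nonneg (hk0 t ht) (by linarith [sq_nonneg (x * u t x + u1 t x)])
    linarith
  · intro t ht
    simp [l t ht, r t ht, r1 t ht]

theorem IsSolution.dInt_deriv_sq_le {T L : ℝ} (hT : 0 ≤ T) (hL : 0 ≤ L)
    {u u1 u2 u3 ut : ℝ → ℝ → ℝ} (S : IsSolution T L u u1 u2 u3 ut) :
    dInt T L (fun t x => u1 t x ^ 2) ≤ Real.exp (L * T) * ∫ x in (0:ℝ)..L, x * u 0 x ^ 2 := by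
  have ⟨c, c1, c2, c3, ct, dx, dx1, dx2, dt, eq, l, r, r1⟩ := S
  have hk : ∀ t, HasDerivAt (fun t => Real.exp (-(L * t))) (-L * Real.exp (-(L * t))) t := fun t =>
    (((hasDerivAt_id' t).const_mul L).fun_neg.exp).congr_deriv (by ring)
  have h := S.weighted_energy hT hL hk (by fun_prop) fun t _ => (Real.exp_pos _).le
  have h1 : -(∫ x in (0:ℝ)..L, x * u 0 x ^ 2) ≤ ∫ x in (0:ℝ)..L, (Real.exp (-(L * T)) *
      (x * u T x ^ 2) - Real.exp (-(L * 0)) * (x * u 0 x ^ 2)) := by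
    rw [← intervalIntegral.integral_neg]
    refine intervalIntegral.integral_mono_on hL (Continuous.intervalIntegrable (by fun_prop) _ _)
      (Continuous.intervalIntegrable (by fun_prop) _ _) fun x hx => ?_
    have : 0 ≤ Real.exp (-(L * T)) * (x * u T x ^ 2) :=
      mul_nonneg (Real.exp_pos _).le (mul_nonneg hx.1 (sq_nonneg _))
    simpa using this
  have h2 : dInt T L (fun t x => -L * Real.exp (-(L * t)) * (x * u t x ^ 2) +
        Real.exp (-(L * t)) * (L * (x * u t x ^ 2) - 2 * u1 t x ^ 2)) ≤
      dInt T L (fun t x => -Real.exp (-(L * T)) * u1 t x ^ 2) := by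
    refine dInt_mono hT hL (by fun_prop) (by fun_prop) fun t ht x _ => ?_
    have : Real.exp (-(L * T)) ≤ Real.exp (-(L * t)) :=
      Real.exp_le_exp.2 (neg_le_neg (mul_le_mul_of_nonneg_left ht.2 hL))
    have h3 := mul_le_mul_of_nonneg_right this (sq_nonneg (u1 t x))
    have h4 := mul_nonneg (Real.exp_pos (-(L * t))).le (sq_nonneg (u1 t x))
    linarith
  rw [dInt_const_mul] at h2
  have h5 : Real.exp (-(L * T)) * dInt T L (fun t x => u1 t x ^ 2) ≤
      ∫ x in (0:ℝ)..L, x * u 0 x ^ 2 := by linarith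
  calc _ = Real.exp (L * T) * (Real.exp (-(L * T)) * dInt T L (fun t x => u1 t x ^ 2)) := by
        rw [← mul_assoc, ← Real.exp_add]; simp
    _ ≤ _ := mul_le_mul_of_nonneg_left h5 (Real.exp_pos _).le

/-- Poincaré inequality for functions vanishing at the left endpoint. -/
theorem dInt_sq_le {T L m : ℝ} (hT : 0 ≤ T) (hm : 0 ≤ m)
    {u u1 u2 u3 ut : ℝ → ℝ → ℝ} (S : IsSolution T L u u1 u2 u3 ut) :
    dInt T m (fun t x => u t x ^ 2) ≤ 4 * m ^ 2 * dInt T m (fun t x => u1 t x ^ 2) := by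
  have ⟨c, c1, c2, c3, ct, dx, dx1, dx2, dt, eq, l, r, r1⟩ := S
  have h := dInt_nonneg_of_deriv_le (H := fun t x => 4 * m ^ 2 * u1 t x ^ 2 + (-1) * u t x ^ 2)
    (g := fun t x => -2 * (x - m) * u t x ^ 2)
    (gx := fun t x => -2 * u t x ^ 2 - 4 * (x - m) * u t x * u1 t x) hT hm ?_ (by fun_prop)
    (by fun_prop) ?_ ?_
  · rw [dInt_add _ _ (by fun_prop) (by fun_prop), dInt_const_mul, dInt_const_mul] at h
    linarith
  · intro t x
    refine ((((hasDerivAt_id' x).sub_const m).const_mul (-2)).fun_mul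
      ((dx t x).fun_pow 2)).congr_deriv ?_
    push_cast
    ring
  · intro t _ x hx
    have h1 : (x - m) ^ 2 ≤ m ^ 2 := by nlinarith [hx.1, hx.2]
    nlinarith [sq_nonneg (u t x + 2 * (x - m) * u1 t x),
      mul_le_mul_of_nonneg_right h1 (sq_nonneg (u1 t x))]
  · intro t ht
    simp [l t ht]

/-- Parabolic-type smoothing: the time derivative is controlled by the energy. -/
theorem exists_smoothing {T L : ℝ} (hT : 0 < T) (hL : 0 < L) :
    ∃ C : ℝ, 0 < C ∧ ∀ w w1 w2 w3 z z1 z2 z3 zt : ℝ → ℝ → ℝ, IsSolution T L w w1 w2 w3 z →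
      IsSolution T L z z1 z2 z3 zt →
      dInt T L (fun t x => t ^ 2 * x * z t x ^ 2) ≤ C * dInt T L (fun t x => w1 t x ^ 2) := by
  obtain ⟨N, hN⟩ : ∃ N : ℝ, N = 3 + L * T := ⟨_, rfl⟩
  have hN0 : 0 < N := by rw [hN]; positivity
  obtain ⟨A, hA⟩ : ∃ A : ℝ, A = T ^ 2 * L + N * T + 2 * N * (2 * T + T * L ^ 2 + 2 * N * L ^ 3) :=
    ⟨_, rfl⟩
  have hA0 : 0 < A := by rw [hA]; positivity
  refine ⟨4 * A, by positivity, fun w w1 w2 w3 z z1 z2 z3 zt S R => ?_⟩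
  have ⟨c, c1, c2, c3, ct, dx, dx1, dx2, dt, eq, l, r, r1⟩ := S
  have ⟨_, cz1, cz2, cz3, czt, dzx, dzx1, dzx2, dzt, eqz, lz, rz, rz1⟩ := R
  have hY : 2 * dInt T L (fun t x => t ^ 3 * z1 t x ^ 2) ≤
      N * dInt T L (fun t x => t ^ 2 * x * z t x ^ 2) := by
    have h := R.weighted_energy hT.le hL.le (k := fun t => t ^ 3) (k' := fun t => 3 * t ^ 2)
      (fun t => by simpa using hasDerivAt_pow 3 t) (by fun_prop) fun t ht => pow_nonneg ht.1 3
    have h1 : 0 ≤ ∫ x in (0:ℝ)..L, (T ^ 3 * (x * z T x ^ 2) - 0 ^ 3 * (x * z 0 x ^ 2)) := by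
      refine intervalIntegral.integral_nonneg hL.le fun x hx => ?_
      have : 0 ≤ T ^ 3 * (x * z T x ^ 2) :=
        mul_nonneg (pow_nonneg hT.le 3) (mul_nonneg hx.1 (sq_nonneg _))
      simpa using this
    have h2 : dInt T L (fun t x => 3 * t ^ 2 * (x * z t x ^ 2) +
          t ^ 3 * (L * (x * z t x ^ 2) - 2 * z1 t x ^ 2)) ≤
        dInt T L (fun t x => N * (t ^ 2 * x * z t x ^ 2) + (-2) * (t ^ 3 * z1 t x ^ 2)) := by
      refine dInt_mono hT.le hL.le (by fun_prop) (by fun_prop) fun t ht x hx => ?_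
      have h3 : t * (L * (t ^ 2 * x * z t x ^ 2)) ≤ T * (L * (t ^ 2 * x * z t x ^ 2)) :=
        mul_le_mul_of_nonneg_right ht.2
          (mul_nonneg hL.le (mul_nonneg (mul_nonneg (sq_nonneg _) hx.1) (sq_nonneg _)))
      rw [hN]
      linarith
    have h3 := h1.trans (h.trans h2)
    rw [dInt_add _ _ (by fun_prop) (by fun_prop), dInt_const_mul, dInt_const_mul] at h3
    linarith
  have h := dInt_nonneg_of_deriv_le
    (H := fun t x => -(1 / 2) * (t ^ 2 * x * z t x ^ 2) +
      ((1 / (2 * N)) * (t ^ 3 * z1 t x ^ 2) + A * w1 t x ^ 2))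
    (g := fun t x => -(t ^ 2 * (z t x * w1 t x - x * z t x * w2 t x)) -
      2 * N * (t * (x ^ 2 * w1 t x * w2 t x)))
    (gx := fun t x => -(t ^ 2 * (z1 t x * w1 t x - x * z1 t x * w2 t x - x * z t x * w3 t x)) -
      2 * N * (t * (2 * x * w1 t x * w2 t x + x ^ 2 * w2 t x ^ 2 + x ^ 2 * w1 t x * w3 t x)))
    hT.le hL.le ?_ (by fun_prop) (by fun_prop) ?_ ?_
  · rw [dInt_add _ _ (by fun_prop) (by fun_prop), dInt_add _ _ (by fun_prop) (by fun_prop),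
      dInt_const_mul, dInt_const_mul, dInt_const_mul] at h
    have h4 : 1 / (2 * N) * dInt T L (fun t x => t ^ 3 * z1 t x ^ 2) ≤
        1 / 4 * dInt T L (fun t x => t ^ 2 * x * z t x ^ 2) := by
      have := mul_le_mul_of_nonneg_left hY (by positivity : 0 ≤ 1 / (4 * N))
      calc _ = 1 / (4 * N) * (2 * dInt T L (fun t x => t ^ 3 * z1 t x ^ 2)) := by
            field_simp; ring
        _ ≤ _ := this
        _ = _ := by field_simp
    linarith
  · intro t x
    refine (((((dzx t x).fun_mul (dx1 t x)).fun_sub (((hasDerivAt_id' x).fun_mul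
      (dzx t x)).fun_mul (dx2 t x))).const_mul (t ^ 2)).fun_neg.fun_sub
      ((((((hasDerivAt_id' x).fun_pow 2).fun_mul (dx1 t x)).fun_mul (dx2 t x)).const_mul
        t).const_mul (2 * N))).congr_deriv ?_
    push_cast
    ring
  · intro t ht x hx
    have hw3 : w3 t x = -z t x - w1 t x := by linarith [eq t ht x hx]
    obtain ⟨ht0, htT⟩ := ht
    obtain ⟨hx0, hxL⟩ := hx
    have hAtx : t ^ 2 * x + N * t + 2 * N * (2 * t + t * x ^ 2 + 2 * N * x ^ 3) ≤ A := by
      rw [hA]; gcongr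
    have h5 := mul_le_mul_of_nonneg_right hAtx (sq_nonneg (w1 t x))
    have h6 : 0 ≤ t * N * (t * z1 t x / (2 * N) + w1 t x) ^ 2 := by positivity
    have h7 : 0 ≤ t * N * (t * z1 t x / (2 * N) - x * w2 t x) ^ 2 := by positivity
    have h8 : 0 ≤ t ^ 2 * x * (z t x / 2 + w1 t x) ^ 2 := by positivity
    have h9 : 0 ≤ N * t * (x * w2 t x + 2 * w1 t x) ^ 2 := by positivity
    have h10 : 0 ≤ 4 * N ^ 2 * x * (x * w1 t x - t * z t x / (4 * N)) ^ 2 := by positivity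
    rw [hw3]
    field_simp at h6 h7 h8 h9 h10 ⊢
    nlinarith
  · intro t ht
    simp [lz t ht, rz t ht, r1 t ht]

theorem exists_bound (h : ℝ → ℝ) (hh : Continuous h) (a b : ℝ) :
    ∃ B : ℝ, 0 < B ∧ ∀ x ∈ Icc a b, |h x| ≤ B := by
  obtain ⟨B, hB⟩ := isCompact_Icc.exists_bound_of_continuousOn (s := Icc a b) hh.continuousOn
  exact ⟨max B 1, by positivity, fun x hx => (hB x hx).trans (le_max_left _ _)⟩

/-- A smooth cutoff, bundled with its derivatives: it vanishes near `[0, m / 4]` and equals `1`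
beyond `m`. -/
structure IsCutoff (m : ℝ) (χ χ1 χ2 χ3 : ℝ → ℝ) : Prop where
  cont : Continuous χ
  cont1 : Continuous χ1
  cont2 : Continuous χ2
  cont3 : Continuous χ3
  d : ∀ x, HasDerivAt χ (χ1 x) x
  d1 : ∀ x, HasDerivAt χ1 (χ2 x) x
  d2 : ∀ x, HasDerivAt χ2 (χ3 x) x
  nonneg : ∀ x, 0 ≤ χ x
  le_one : ∀ x, χ x ≤ 1
  left : ∀ x ≤ m / 4, χ x = 0 ∧ χ1 x = 0 ∧ χ2 x = 0 ∧ χ3 x = 0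
  right : ∀ x, m ≤ x → χ x = 1 ∧ χ1 x = 0 ∧ χ2 x = 0 ∧ χ3 x = 0

theorem deriv_eq_zero_of_forall_mem {f : ℝ → ℝ} {c : ℝ} {s : Set ℝ} (hs : IsOpen s)
    (h : ∀ x ∈ s, f x = c) : ∀ x ∈ s, deriv f x = 0 := fun x hx => by
  have : f =ᶠ[nhds x] fun _ => c := Filter.eventually_of_mem (hs.mem_nhds hx) h
  rw [this.deriv_eq, deriv_const]

theorem exists_isCutoff {m : ℝ} (hm : 0 < m) : ∃ χ χ1 χ2 χ3 : ℝ → ℝ, IsCutoff m χ χ1 χ2 χ3 := by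
  obtain ⟨χ, hχ⟩ : ∃ χ : ℝ → ℝ, χ = fun x => Real.smoothTransition (3 * x / m - 1) := ⟨_, rfl⟩
  have h0 : ContDiff ℝ 3 χ := by
    rw [hχ]; exact Real.smoothTransition.contDiff.comp (by fun_prop)
  have h1 : ContDiff ℝ 2 (deriv χ) := h0.deriv'
  have h2 : ContDiff ℝ 1 (deriv (deriv χ)) := h1.deriv'
  have h3 : Continuous (deriv (deriv (deriv χ))) := h2.continuous_deriv le_rfl
  have l0 : ∀ x ∈ Iio (m / 3), χ x = 0 := fun x hx => by
    rw [hχ]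
    refine Real.smoothTransition.zero_of_nonpos ?_
    have : 3 * x / m ≤ 1 := by rw [div_le_one hm]; linarith [mem_Iio.1 hx]
    linarith
  have r0 : ∀ x ∈ Ioi (2 * m / 3), χ x = 1 := fun x hx => by
    rw [hχ]
    refine Real.smoothTransition.one_of_one_le ?_
    have : 2 ≤ 3 * x / m := by rw [le_div_iff₀ hm]; linarith [mem_Ioi.1 hx]
    linarith
  have l1 := deriv_eq_zero_of_forall_mem isOpen_Iio l0
  have l2 := deriv_eq_zero_of_forall_mem isOpen_Iio l1
  have l3 := deriv_eq_zero_of_forall_mem isOpen_Iio l2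
  have r1 := deriv_eq_zero_of_forall_mem isOpen_Ioi r0
  have r2 := deriv_eq_zero_of_forall_mem isOpen_Ioi r1
  have r3 := deriv_eq_zero_of_forall_mem isOpen_Ioi r2
  refine ⟨χ, _, _, _, h0.continuous, h1.continuous, h2.continuous, h3,
    fun x => (h0.differentiable (by norm_num) x).hasDerivAt,
    fun x => (h1.differentiable (by norm_num) x).hasDerivAt,
    fun x => (h2.differentiable (by norm_num) x).hasDerivAt,
    fun x => by rw [hχ]; exact Real.smoothTransition.nonneg _,
    fun x => by rw [hχ]; exact Real.smoothTransition.le_one _, fun x hx => ?_, fun x hx => ?_⟩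
  · have : x ∈ Iio (m / 3) := mem_Iio.2 (by linarith)
    exact ⟨l0 x this, l1 x this, l2 x this, l3 x this⟩
  · have : x ∈ Ioi (2 * m / 3) := mem_Ioi.2 (by linarith)
    exact ⟨r0 x this, r1 x this, r2 x this, r3 x this⟩

/-- Interior bound for the second space derivative on the observation region. -/
theorem exists_local_bound {T L m : ℝ} (hT : 0 < T) (hm : 0 < m) (hmL : m ≤ L)
    {χ χ1 χ2 χ3 : ℝ → ℝ} (hχ : IsCutoff m χ χ1 χ2 χ3) {δ : ℝ} (hδ : 0 < δ) :
    ∃ C : ℝ, 0 < C ∧ ∀ w w1 w2 w3 z : ℝ → ℝ → ℝ, IsSolution T L w w1 w2 w3 z →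
      dInt T m (fun t x => t ^ 2 * χ1 x ^ 2 * w2 t x ^ 2) ≤
        δ * dInt T L (fun t x => t ^ 2 * x * z t x ^ 2) +
          C * dInt T m (fun t x => w1 t x ^ 2) := by
  have ⟨k0, k1, k2, k3, d, d1, d2, _, _, hl, hr⟩ := hχ
  obtain ⟨B, hB, hB'⟩ := exists_bound (fun x => χ1 x ^ 2) (by fun_prop) 0 m
  obtain ⟨D, hD, hD'⟩ := exists_bound (fun x => χ2 x ^ 2 + χ1 x * χ3 x) (by fun_prop) 0 m
  obtain ⟨A, hA⟩ : ∃ A : ℝ, A = 4 * B ^ 2 / m := ⟨_, rfl⟩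
  have hA0 : 0 < A := by rw [hA]; positivity
  have hη : ∀ x ∈ Icc 0 m, (χ1 x ^ 2) ^ 2 ≤ A * x := fun x hx => by
    rcases le_or_gt x (m / 4) with h | h
    · rw [(hl x h).2.1]
      simpa using mul_nonneg hA0.le hx.1
    · have h1 : (χ1 x ^ 2) ^ 2 ≤ B ^ 2 := by
        have := hB' x hx
        rw [abs_of_nonneg (sq_nonneg _)] at this
        exact pow_le_pow_left₀ (sq_nonneg _) this 2
      refine h1.trans ?_
      rw [hA, div_mul_eq_mul_div, le_div_iff₀ hm]
      nlinarith [sq_nonneg B]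
  refine ⟨T ^ 2 * (B + D + A / (4 * δ)), by positivity, fun w w1 w2 w3 z S => ?_⟩
  have ⟨c, c1, c2, c3, ct, dx, dx1, dx2, dt, eq, l, r, r1⟩ := S
  have h := dInt_nonneg_of_deriv_le
    (H := fun t x => (-1) * (t ^ 2 * χ1 x ^ 2 * w2 t x ^ 2) + (δ * (t ^ 2 * x * z t x ^ 2) +
      T ^ 2 * (B + D + A / (4 * δ)) * w1 t x ^ 2))
    (g := fun t x => -t ^ 2 * (χ1 x ^ 2 * (w1 t x * w2 t x) - χ1 x * χ2 x * w1 t x ^ 2))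
    (gx := fun t x => -t ^ 2 * (χ1 x ^ 2 * (w2 t x ^ 2 + w1 t x * w3 t x) -
      (χ2 x ^ 2 + χ1 x * χ3 x) * w1 t x ^ 2)) hT.le hm.le ?_ (by fun_prop) (by fun_prop) ?_ ?_
  · rw [dInt_add _ _ (by fun_prop) (by fun_prop), dInt_add _ _ (by fun_prop) (by fun_prop),
      dInt_const_mul, dInt_const_mul, dInt_const_mul] at h
    have h1 : dInt T m (fun t x => t ^ 2 * x * z t x ^ 2) ≤
        dInt T L (fun t x => t ^ 2 * x * z t x ^ 2) :=
      dInt_mono_right hT.le hm.le hmL (by fun_prop) fun t _ x hx =>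
        mul_nonneg (mul_nonneg (sq_nonneg _) hx.1) (sq_nonneg _)
    have h2 := mul_le_mul_of_nonneg_left h1 hδ.le
    linarith
  · intro t x
    refine (((((d1 x).fun_pow 2).fun_mul ((dx1 t x).fun_mul (dx2 t x))).fun_sub
      (((d1 x).fun_mul (d2 x)).fun_mul ((dx1 t x).fun_pow 2))).const_mul (-t ^ 2)).congr_deriv ?_
    push_cast
    ring
  · intro t ht x hx
    have hw3 : w3 t x = -z t x - w1 t x := by linarith [eq t ht x ⟨hx.1, hx.2.trans hmL⟩]
    rw [hw3]
    have e1 : 0 ≤ A / (4 * δ) * (w1 t x - 2 * δ * χ1 x ^ 2 * z t x / A) ^ 2 := by positivity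
    have e2 : 0 ≤ δ / A * z t x ^ 2 * (A * x - (χ1 x ^ 2) ^ 2) :=
      mul_nonneg (by positivity) (by linarith [hη x hx])
    have e3 : χ1 x ^ 2 * (w1 t x * z t x) ≤ δ * (x * z t x ^ 2) + A / (4 * δ) * w1 t x ^ 2 := by
      have : δ * (x * z t x ^ 2) + A / (4 * δ) * w1 t x ^ 2 - χ1 x ^ 2 * (w1 t x * z t x) =
          A / (4 * δ) * (w1 t x - 2 * δ * χ1 x ^ 2 * z t x / A) ^ 2 +
          δ / A * z t x ^ 2 * (A * x - (χ1 x ^ 2) ^ 2) := by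
        field_simp
        ring
      linarith
    have e4 := mul_le_mul_of_nonneg_right ((le_abs_self _).trans (hB' x hx)) (sq_nonneg (w1 t x))
    have e5 := mul_le_mul_of_nonneg_right ((le_abs_self _).trans (hD' x hx)) (sq_nonneg (w1 t x))
    have e6 : t ^ 2 ≤ T ^ 2 := pow_le_pow_left₀ ht.1 ht.2 2
    have e7 : 0 ≤ (B + D + A / (4 * δ)) * w1 t x ^ 2 := by positivity
    have e8 := mul_le_mul_of_nonneg_right e6 e7
    have e9 : 0 ≤ t ^ 2 * (δ * (x * z t x ^ 2) + (B + D + A / (4 * δ)) * w1 t x ^ 2 -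
        (χ1 x ^ 2 * (w1 t x * z t x) + χ1 x ^ 2 * w1 t x ^ 2 +
          (χ2 x ^ 2 + χ1 x * χ3 x) * w1 t x ^ 2)) :=
      mul_nonneg (sq_nonneg _) (by linarith)
    linarith
  · intro t _
    simp [(hl 0 (by linarith)).2.1, (hr m le_rfl).2.1]

theorem exists_time_weight {T : ℝ} (hT : 0 < T) (n : ℕ) : ∃ k : ℝ → ℝ,
    (∀ t, HasDerivAt k (-(t * (T - t)) ^ (2 * n)) t) ∧ k T = 0 ∧
      T / 2 * (T ^ 2 / 8) ^ (2 * n) ≤ k 0 := by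
  obtain ⟨κ, hκ⟩ : ∃ κ : ℝ → ℝ, κ = fun t => (t * (T - t)) ^ (2 * n) := ⟨_, rfl⟩
  have cκ : Continuous κ := by rw [hκ]; fun_prop
  have κ0 : ∀ t, 0 ≤ κ t := fun t => by rw [hκ]; exact (even_two_mul n).pow_nonneg _
  refine ⟨fun t => (∫ s in (0:ℝ)..T, κ s) - ∫ s in (0:ℝ)..t, κ s, fun t => ?_, by simp, ?_⟩
  · have := (cκ.integral_hasStrictDerivAt 0 t).hasDerivAt.const_sub (∫ s in (0:ℝ)..T, κ s)
    refine this.congr_deriv ?_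
    rw [hκ]
  · have h1 : ∫ s in (T / 4)..(3 * T / 4), κ s ≤ ∫ s in (0:ℝ)..T, κ s :=
      intervalIntegral.integral_mono_interval (by linarith) (by linarith) (by linarith)
        (Filter.Eventually.of_forall κ0) (cκ.intervalIntegrable _ _)
    have h2 : ∫ s in (T / 4)..(3 * T / 4), (T ^ 2 / 8) ^ (2 * n) ≤
        ∫ s in (T / 4)..(3 * T / 4), κ s := by
      refine intervalIntegral.integral_mono_on (by linarith) (by simp)
        (cκ.intervalIntegrable _ _) fun s hs => ?_
      rw [hκ]
      refine pow_le_pow_left₀ (by positivity) ?_ _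
      nlinarith [mul_nonneg (sub_nonneg.2 hs.1) (sub_nonneg.2 hs.2)]
    rw [intervalIntegral.integral_const, smul_eq_mul] at h2
    have : 3 * T / 4 - T / 4 = T / 2 := by ring
    rw [this] at h2
    simpa using h2.trans h1

theorem exists_energy_bound {T L m : ℝ} (hT : 0 < T) (hm : 0 < m) (hmL : m ≤ L)
    {χ χ1 χ2 χ3 : ℝ → ℝ} (hχ : IsCutoff m χ χ1 χ2 χ3) :
    ∃ c₀ : ℝ, 0 < c₀ ∧ ∀ n : ℕ, ∃ C : ℝ, 0 < C ∧ ∀ w w1 w2 w3 z : ℝ → ℝ → ℝ,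
      IsSolution T L w w1 w2 w3 z →
        c₀ * (T ^ 2 / 8) ^ (2 * n) * ∫ x in (0:ℝ)..L, x * w 0 x ^ 2 ≤
          dInt T L (fun t x => (t * (T - t)) ^ (2 * n) * (χ x ^ 2 * w t x ^ 2)) +
            C * dInt T m (fun t x => w1 t x ^ 2) := by
  have ⟨k0, k1, k2, k3, d, d1, d2, h0, h1, hl, hr⟩ := hχ
  have hL : 0 < L := hm.trans_le hmL
  obtain ⟨q, hq⟩ : ∃ q : ℝ → ℝ, q = fun x => x * (1 - χ x) + χ x := ⟨_, rfl⟩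
  obtain ⟨q1, hq1⟩ : ∃ q1 : ℝ → ℝ, q1 = fun x => 1 - χ x - x * χ1 x + χ1 x := ⟨_, rfl⟩
  obtain ⟨q2, hq2⟩ : ∃ q2 : ℝ → ℝ, q2 = fun x => -2 * χ1 x - x * χ2 x + χ2 x := ⟨_, rfl⟩
  obtain ⟨q3, hq3⟩ : ∃ q3 : ℝ → ℝ, q3 = fun x => -3 * χ2 x - x * χ3 x + χ3 x := ⟨_, rfl⟩
  have cq : Continuous q := by rw [hq]; fun_prop
  have cq1 : Continuous q1 := by rw [hq1]; fun_prop
  have cq2 : Continuous q2 := by rw [hq2]; fun_prop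
  have cq3 : Continuous q3 := by rw [hq3]; fun_prop
  have dq : ∀ x, HasDerivAt q (q1 x) x := fun x => by
    rw [hq, hq1]
    exact (((hasDerivAt_id' x).fun_mul ((d x).const_sub 1)).fun_add (d x)).congr_deriv (by ring)
  have dq1 : ∀ x, HasDerivAt q1 (q2 x) x := fun x => by
    rw [hq1, hq2]
    exact ((((d x).const_sub 1).fun_sub ((hasDerivAt_id' x).fun_mul (d1 x))).fun_add
      (d1 x)).congr_deriv (by ring)
  have dq2 : ∀ x, HasDerivAt q2 (q3 x) x := fun x => by
    rw [hq2, hq3]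
    exact ((((d1 x).const_mul (-2)).fun_sub ((hasDerivAt_id' x).fun_mul (d2 x))).fun_add
      (d2 x)).congr_deriv (by ring)
  have q0 : q 0 = 0 := by rw [hq]; simp [(hl 0 (by linarith)).1]
  have qr : ∀ x, m ≤ x → q x = 1 ∧ q1 x = 0 ∧ q3 x = 0 := fun x hx => by
    rw [hq, hq1, hq3]; simp [hr x hx]
  have qlow : ∀ x ∈ Icc 0 L, x / (1 + L) ≤ q x := fun x hx => by
    rw [hq, div_le_iff₀ (by positivity)]
    have e1 := mul_nonneg hx.1 (sub_nonneg.2 (h1 x))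
    have e2 := mul_nonneg hL.le e1
    have e3 := mul_nonneg (h0 x) (sub_nonneg.2 hx.2)
    have e4 := h0 x
    nlinarith
  refine ⟨T / 2 / (1 + L), by positivity, fun n => ?_⟩
  obtain ⟨k, dk, kT, klow⟩ := exists_time_weight hT n
  have ck : Continuous k := continuous_iff_continuousAt.2 fun t => (dk t).continuousAt
  obtain ⟨κ, hκ⟩ : ∃ κ : ℝ → ℝ, κ = fun t => (t * (T - t)) ^ (2 * n) := ⟨_, rfl⟩
  have cκ : Continuous κ := by rw [hκ]; fun_prop
  have κ0 : ∀ t, 0 ≤ κ t := fun t => by rw [hκ]; exact (even_two_mul n).pow_nonneg _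
  have dk' : ∀ t, HasDerivAt k (-κ t) t := fun t => by rw [hκ]; exact dk t
  obtain ⟨A, hA, hA'⟩ := exists_bound κ cκ 0 T
  obtain ⟨B, hB, hB'⟩ := exists_bound k ck 0 T
  obtain ⟨Q, hQ, hQ'⟩ := exists_bound q cq 0 m
  obtain ⟨Q1, hQ1, hQ1'⟩ := exists_bound q1 cq1 0 m
  obtain ⟨Q3, hQ3, hQ3'⟩ := exists_bound q3 cq3 0 m
  refine ⟨(A * Q + B * (Q1 + Q3)) * (4 * m ^ 2) + 3 * (B * Q1), by positivity,
    fun w w1 w2 w3 z S => ?_⟩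
  have ⟨c, c1, c2, c3, ct, dx, dx1, dx2, dt, eq, l, r, r1⟩ := S
  have h := integral_sub_le_dInt hT.le hL.le (f := fun t x => -(k t * (q x * w t x ^ 2)))
    (ft := fun t x => κ t * (q x * w t x ^ 2) - k t * (q x * (2 * w t x * z t x)))
    (g := fun t x => -k t * (q x * w t x ^ 2 + 2 * q x * (w t x * w2 t x) -
      2 * q1 x * (w t x * w1 t x) + q2 x * w t x ^ 2 - q x * w1 t x ^ 2))
    (gx := fun t x => -k t * (q1 x * w t x ^ 2 + 2 * q x * (w t x * w1 t x) +
      2 * q x * (w t x * w3 t x) - 3 * q1 x * w1 t x ^ 2 + q3 x * w t x ^ 2))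
    (H := fun t x => κ t * (q x * w t x ^ 2) - k t * ((q1 x + q3 x) * w t x ^ 2) +
      3 * (k t * q1 x) * w1 t x ^ 2) ?_ ?_ (by fun_prop) (by fun_prop) (by fun_prop) ?_ ?_
  · have e1 := dInt_le_add_of_le hT.le hm.le hmL
      (F := fun t x => κ t * (q x * w t x ^ 2) - k t * ((q1 x + q3 x) * w t x ^ 2) +
        3 * (k t * q1 x) * w1 t x ^ 2)
      (G := fun t x => (t * (T - t)) ^ (2 * n) * (χ x ^ 2 * w t x ^ 2))
      (H := fun t x => (A * Q + B * (Q1 + Q3)) * w t x ^ 2 + 3 * (B * Q1) * w1 t x ^ 2)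
      (by fun_prop) (by fun_prop) (by fun_prop) ?_ ?_
    · replace e1 := h.trans e1
      rw [dInt_add _ _ (by fun_prop) (by fun_prop), dInt_const_mul, dInt_const_mul] at e1
      have e2 := mul_le_mul_of_nonneg_left (dInt_sq_le hT.le hm.le S)
        (by positivity : 0 ≤ A * Q + B * (Q1 + Q3))
      have e3 : T / 2 / (1 + L) * (T ^ 2 / 8) ^ (2 * n) * ∫ x in (0:ℝ)..L, x * w 0 x ^ 2 ≤
          ∫ x in (0:ℝ)..L, (-(k T * (q x * w T x ^ 2)) - -(k 0 * (q x * w 0 x ^ 2))) := by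
        rw [← intervalIntegral.integral_const_mul]
        refine intervalIntegral.integral_mono_on hL.le
          (Continuous.intervalIntegrable (by fun_prop) _ _)
          (Continuous.intervalIntegrable (by fun_prop) _ _) fun x hx => ?_
        rw [kT]
        have e4 : T / 2 * (T ^ 2 / 8) ^ (2 * n) * (x / (1 + L)) ≤ k 0 * q x :=
          mul_le_mul klow (qlow x hx) (div_nonneg hx.1 (by positivity))
            (le_trans (by positivity) klow)
        have e5 := mul_le_mul_of_nonneg_right e4 (sq_nonneg (w 0 x))
        calc _ = T / 2 * (T ^ 2 / 8) ^ (2 * n) * (x / (1 + L)) * w 0 x ^ 2 := by ring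
          _ ≤ _ := e5
          _ = _ := by ring
      linarith
    · intro t ht x hx
      have f1 : κ t * q x ≤ A * Q := mul_le_mul ((le_abs_self _).trans (hA' t ht))
        ((le_abs_self _).trans (hQ' x hx)) (by
          have := qlow x ⟨hx.1, hx.2.trans hmL⟩
          exact (div_nonneg hx.1 (by positivity)).trans this) hA.le
      have f2 : -(k t * (q1 x + q3 x)) ≤ B * (Q1 + Q3) := by
        refine (neg_le_abs _).trans ?_
        rw [abs_mul]
        exact mul_le_mul (hB' t ht) ((abs_add_le _ _).trans (add_le_add (hQ1' x hx) (hQ3' x hx)))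
          (abs_nonneg _) hB.le
      have f3 : k t * q1 x ≤ B * Q1 := by
        refine (le_abs_self _).trans ?_
        rw [abs_mul]
        exact mul_le_mul (hB' t ht) (hQ1' x hx) (abs_nonneg _) hB.le
      have f4 : 0 ≤ (t * (T - t)) ^ (2 * n) * (χ x ^ 2 * w t x ^ 2) :=
        mul_nonneg ((even_two_mul n).pow_nonneg _) (by positivity)
      have f5 := mul_le_mul_of_nonneg_right f1 (sq_nonneg (w t x))
      have f6 := mul_le_mul_of_nonneg_right f2 (sq_nonneg (w t x))
      have f7 := mul_le_mul_of_nonneg_right f3 (sq_nonneg (w1 t x))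
      linarith
    · intro t ht x hx
      simp [qr x hx.1, hr x hx.1, hκ]
  · intro t x
    exact ((dk' t).fun_mul (((dt t x).fun_pow 2).const_mul (q x))).fun_neg.congr_deriv
      (by push_cast; ring)
  · intro t x
    refine ((((((dq x).fun_mul ((dx t x).fun_pow 2)).fun_add (((dq x).const_mul 2).fun_mul
      ((dx t x).fun_mul (dx2 t x)))).fun_sub (((dq1 x).const_mul 2).fun_mul
      ((dx t x).fun_mul (dx1 t x)))).fun_add ((dq2 x).fun_mul ((dx t x).fun_pow 2))).fun_sub
      ((dq x).fun_mul ((dx1 t x).fun_pow 2))).const_mul (-k t) |>.congr_deriv ?_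
    push_cast
    ring
  · intro t ht x hx
    rw [eq t ht x hx]
    linarith
  · intro t ht
    simp [l t ht, r t ht, r1 t ht, q0]

/-- Carleman-type inequality for `∂ₜ + (∂ₓ + q)³` with `q = s (2 L - x)`, obtained by splitting the
conjugated operator into its symmetric and skew-symmetric parts. -/
theorem dInt_conjugated_nonneg {T L s : ℝ} (hT : 0 ≤ T) (hL : 0 ≤ L) (hs : 0 ≤ s)
    {v v1 v2 v3 vt v1t : ℝ → ℝ → ℝ}
    (c : Continuous fun p : ℝ × ℝ => v p.1 p.2) (c1 : Continuous fun p : ℝ × ℝ => v1 p.1 p.2)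
    (c2 : Continuous fun p : ℝ × ℝ => v2 p.1 p.2) (c3 : Continuous fun p : ℝ × ℝ => v3 p.1 p.2)
    (ct : Continuous fun p : ℝ × ℝ => vt p.1 p.2) (c1t : Continuous fun p : ℝ × ℝ => v1t p.1 p.2)
    (dx : ∀ t x, HasDerivAt (v t) (v1 t x) x) (dx1 : ∀ t x, HasDerivAt (v1 t) (v2 t x) x)
    (dx2 : ∀ t x, HasDerivAt (v2 t) (v3 t x) x)
    (dt : ∀ t x, HasDerivAt (fun r => v r x) (vt t x) t)
    (dt1 : ∀ t x, HasDerivAt (fun r => v1 r x) (v1t t x) t)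
    (dtx : ∀ t x, HasDerivAt (vt t) (v1t t x) x)
    (left : ∀ t ∈ Icc 0 T, v t 0 = 0 ∧ v1 t 0 = 0 ∧ v2 t 0 = 0)
    (right : ∀ t ∈ Icc 0 T, v t L = 0 ∧ v1 t L = 0)
    (initial : ∀ x, v 0 x = 0 ∧ v1 0 x = 0) (final : ∀ x, v T x = 0 ∧ v1 T x = 0) :
    0 ≤ dInt T L fun t x => 1 / 2 * (vt t x + v3 t x + 3 * (s * (2 * L - x)) * v2 t x +
        3 * ((s * (2 * L - x)) ^ 2 - s) * v1 t x +
        ((s * (2 * L - x)) ^ 3 - 3 * s * (s * (2 * L - x))) * v t x) ^ 2 -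
      (s * (9 * v2 t x ^ 2 + 18 * (s * (2 * L - x)) ^ 2 * v1 t x ^ 2 +
        9 * (s * (2 * L - x)) ^ 4 * v t x ^ 2) - 3 * s ^ 3 * v t x ^ 2) := by
  have dq : ∀ x : ℝ, HasDerivAt (fun x => s * (2 * L - x)) (-s) x := fun x =>
    (((hasDerivAt_id' x).const_sub (2 * L)).const_mul s).congr_deriv (by ring)
  obtain ⟨q, hq⟩ : ∃ q : ℝ → ℝ, q = fun x => s * (2 * L - x) := ⟨_, rfl⟩
  have hq' : ∀ x, s * (2 * L - x) = q x := fun x => by rw [hq]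
  rw [← hq] at dq
  have cq : Continuous q := by rw [hq]; fun_prop
  simp only [hq']
  refine le_trans (le_of_eq ?_) (integral_sub_le_dInt hT hL
    (f := fun t x => -3 * (q x * v1 t x ^ 2) + q x ^ 3 * v t x ^ 2)
    (ft := fun t x => -3 * (q x * (2 * v1 t x * v1t t x)) + q x ^ 3 * (2 * v t x * vt t x))
    (g := fun t x => 6 * (q x * (vt t x * v1 t x)) + 3 * (q x * v2 t x ^ 2) -
      6 * s * (v1 t x * v2 t x) + 2 * (q x ^ 3 * (v t x * v2 t x)) - q x ^ 3 * v1 t x ^ 2 +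
      9 * (q x ^ 3 * v1 t x ^ 2) - 3 * s ^ 2 * (q x * v t x ^ 2) + 3 * (q x ^ 5 * v t x ^ 2) -
      12 * s * (q x ^ 2 * (v t x * v1 t x)))
    (gx := fun t x => 2 * ((vt t x + v3 t x + 3 * q x ^ 2 * v1 t x - 3 * s * q x * v t x) *
      (3 * q x * v2 t x - 3 * s * v1 t x + q x ^ 3 * v t x)) -
      (-3 * (q x * (2 * v1 t x * v1t t x)) + q x ^ 3 * (2 * v t x * vt t x)) -
      (s * (9 * v2 t x ^ 2 + 18 * q x ^ 2 * v1 t x ^ 2 +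
        9 * q x ^ 4 * v t x ^ 2) - 3 * s ^ 3 * v t x ^ 2)) ?_ ?_ (by fun_prop) (by fun_prop)
    (by fun_prop) ?_ ?_)
  · simp [initial, final]
  · intro t x
    exact ((((dt1 t x).fun_pow 2).const_mul (q x)).const_mul (-3) |>.fun_add
      (((dt t x).fun_pow 2).const_mul (q x ^ 3))).congr_deriv (by push_cast; ring)
  · intro t x
    refine ((((((((((dq x).fun_mul ((dtx t x).fun_mul (dx1 t x))).const_mul 6).fun_add
      (((dq x).fun_mul ((dx2 t x).fun_pow 2)).const_mul 3)).fun_sub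
      (((dx1 t x).fun_mul (dx2 t x)).const_mul (6 * s))).fun_add
      ((((dq x).fun_pow 3).fun_mul ((dx t x).fun_mul (dx2 t x))).const_mul 2)).fun_sub
      (((dq x).fun_pow 3).fun_mul ((dx1 t x).fun_pow 2))).fun_add
      ((((dq x).fun_pow 3).fun_mul ((dx1 t x).fun_pow 2)).const_mul 9)).fun_sub
      (((dq x).fun_mul ((dx t x).fun_pow 2)).const_mul (3 * s ^ 2))).fun_add
      ((((dq x).fun_pow 5).fun_mul ((dx t x).fun_pow 2)).const_mul 3)).fun_sub
      ((((dq x).fun_pow 2).fun_mul ((dx t x).fun_mul (dx1 t x))).const_mul (12 * s))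
      |>.congr_deriv ?_
    push_cast
    ring
  · intro t ht x hx
    have := sq_nonneg ((vt t x + v3 t x + 3 * q x ^ 2 * v1 t x - 3 * s * q x * v t x) -
      (3 * q x * v2 t x - 3 * s * v1 t x + q x ^ 3 * v t x))
    linarith
  · intro t ht
    have qL : 0 ≤ q L := by rw [hq]; exact mul_nonneg hs (by linarith)
    simp only [left t ht, right t ht]
    have := mul_nonneg qL (sq_nonneg (v2 t L))
    linarith

theorem dInt_weighted_nonneg {T L s : ℝ} (hT : 0 ≤ T) (hL : 0 ≤ L) (hs : 0 ≤ s)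
    {Θ Θ' E : ℝ → ℝ} (dΘ : ∀ t, HasDerivAt Θ (Θ' t) t) (cΘ' : Continuous Θ')
    (hΘ0 : Θ 0 = 0) (hΘT : Θ T = 0) (dE : ∀ x, HasDerivAt E (-(s * (2 * L - x)) * E x) x)
    {U U1 U2 U3 Ut U1t : ℝ → ℝ → ℝ}
    (c : Continuous fun p : ℝ × ℝ => U p.1 p.2) (c1 : Continuous fun p : ℝ × ℝ => U1 p.1 p.2)
    (c2 : Continuous fun p : ℝ × ℝ => U2 p.1 p.2) (c3 : Continuous fun p : ℝ × ℝ => U3 p.1 p.2)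
    (ct : Continuous fun p : ℝ × ℝ => Ut p.1 p.2) (c1t : Continuous fun p : ℝ × ℝ => U1t p.1 p.2)
    (dx : ∀ t x, HasDerivAt (U t) (U1 t x) x) (dx1 : ∀ t x, HasDerivAt (U1 t) (U2 t x) x)
    (dx2 : ∀ t x, HasDerivAt (U2 t) (U3 t x) x)
    (dt : ∀ t x, HasDerivAt (fun r => U r x) (Ut t x) t)
    (dt1 : ∀ t x, HasDerivAt (fun r => U1 r x) (U1t t x) t)
    (dtx : ∀ t x, HasDerivAt (Ut t) (U1t t x) x)
    (left : ∀ t ∈ Icc 0 T, U t 0 = 0 ∧ U1 t 0 = 0 ∧ U2 t 0 = 0)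
    (right : ∀ t ∈ Icc 0 T, U t L = 0 ∧ U1 t L = 0) :
    0 ≤ dInt T L fun t x => 1 / 2 * (E x * (Θ' t * U t x + Θ t * (Ut t x + U3 t x))) ^ 2 -
      s * (18 * (s * (2 * L - x)) ^ 2 * (Θ t * E x * (U1 t x - s * (2 * L - x) * U t x)) ^ 2 +
        9 * (s * (2 * L - x)) ^ 4 * (Θ t * E x * U t x) ^ 2) +
      3 * s ^ 3 * (Θ t * E x * U t x) ^ 2 := by
  have dq : ∀ x : ℝ, HasDerivAt (fun x => s * (2 * L - x)) (-s) x := fun x =>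
    (((hasDerivAt_id' x).const_sub (2 * L)).const_mul s).congr_deriv (by ring)
  have cΘ : Continuous Θ := continuous_iff_continuousAt.2 fun t => (dΘ t).continuousAt
  have cE : Continuous E := continuous_iff_continuousAt.2 fun x => (dE x).continuousAt
  obtain ⟨q, hq⟩ : ∃ q : ℝ → ℝ, q = fun x => s * (2 * L - x) := ⟨_, rfl⟩
  have hq' : ∀ x, s * (2 * L - x) = q x := fun x => by rw [hq]
  have cq : Continuous q := by rw [hq]; fun_prop
  have h := dInt_conjugated_nonneg hT hL hs
    (v := fun t x => Θ t * (E x * U t x))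
    (v1 := fun t x => Θ t * (E x * (U1 t x - q x * U t x)))
    (v2 := fun t x => Θ t * (E x * (U2 t x - 2 * (q x * U1 t x) + (q x ^ 2 + s) * U t x)))
    (v3 := fun t x => Θ t * (E x * (U3 t x - 3 * q x * U2 t x + (3 * q x ^ 2 + 3 * s) * U1 t x -
      (3 * q x * s + q x ^ 3) * U t x)))
    (vt := fun t x => Θ' t * (E x * U t x) + Θ t * (E x * Ut t x))
    (v1t := fun t x => Θ' t * (E x * (U1 t x - q x * U t x)) +
      Θ t * (E x * (U1t t x - q x * Ut t x)))
    (by fun_prop) (by fun_prop) (by fun_prop) (by fun_prop) (by fun_prop) (by fun_prop)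
    ?_ ?_ ?_ ?_ ?_ ?_ ?_ ?_ ?_ ?_
  · simp only [hq'] at h ⊢
    refine h.trans (dInt_mono hT hL (by fun_prop) (by fun_prop) fun t ht x hx => ?_)
    have := mul_nonneg hs (sq_nonneg
      (Θ t * (E x * (U2 t x - 2 * (q x * U1 t x) + (q x ^ 2 + s) * U t x))))
    linarith
  all_goals simp only [hq'] at dE
  all_goals rw [← hq] at dq
  · intro t x
    exact (((dE x).fun_mul (dx t x)).const_mul (Θ t)).congr_deriv (by ring)
  · intro t x
    exact (((dE x).fun_mul ((dx1 t x).fun_sub ((dq x).fun_mul (dx t x)))).const_mul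
      (Θ t)).congr_deriv (by ring)
  · intro t x
    exact (((dE x).fun_mul (((dx2 t x).fun_sub (((dq x).fun_mul (dx1 t x)).const_mul 2)).fun_add
      ((((dq x).fun_pow 2).add_const s).fun_mul (dx t x)))).const_mul (Θ t)).congr_deriv
      (by push_cast; ring)
  · intro t x
    exact (dΘ t).fun_mul ((dt t x).const_mul (E x))
  · intro t x
    exact (dΘ t).fun_mul (((dt1 t x).fun_sub ((dt t x).const_mul (q x))).const_mul (E x))
  · intro t x
    exact ((((dE x).fun_mul (dx t x)).const_mul (Θ' t)).fun_add
      (((dE x).fun_mul (dtx t x)).const_mul (Θ t))).congr_deriv (by ring)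
  · intro t ht
    simp [left t ht]
  · intro t ht
    simp [right t ht]
  · simp [hΘ0]
  · simp [hΘT]

theorem sq_mul_pow_le {μ r : ℝ} (hμ : 0 ≤ μ) (hr : 0 ≤ r) (k : ℕ) :
    μ ^ 2 * r ^ (2 * k) ≤ r ^ (2 * (k + 1)) + μ ^ (2 * (k + 1)) := by
  have e : ∀ y : ℝ, y ^ (2 * (k + 1)) = y ^ 2 * y ^ (2 * k) := fun y => by ring
  rw [e, e]
  rcases le_total μ r with h | h
  · have h1 : μ ^ 2 ≤ r ^ 2 := pow_le_pow_left₀ hμ h 2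
    have h2 : 0 ≤ r ^ (2 * k) := by positivity
    have h3 : 0 ≤ μ ^ 2 * μ ^ (2 * k) := by positivity
    nlinarith
  · have h1 : r ^ (2 * k) ≤ μ ^ (2 * k) := pow_le_pow_left₀ hr h _
    have h3 : 0 ≤ r ^ 2 * r ^ (2 * k) := by positivity
    nlinarith [sq_nonneg μ]

theorem carleman_pointwise {s q Z p a b y W : ℝ}
    (hp : p ^ 2 ≤ Z * s ^ 2 * (a ^ 2 + W)) (h1 : 1 ≤ s * q ^ 2)
    (h2 : 3 * s ^ 3 + 2 * Z * s ^ 2 + 1 ≤ 4 * (s * q ^ 4)) :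
    1 / 2 * (p - b - q * a + y) ^ 2 - s * (18 * q ^ 2 * b ^ 2 + 9 * q ^ 4 * a ^ 2) +
      3 * s ^ 3 * a ^ 2 ≤ -a ^ 2 + 2 * Z * s ^ 2 * W + 2 * y ^ 2 := by
  have e1 : (p - b - q * a + y) ^ 2 ≤ 4 * (p ^ 2 + b ^ 2 + (q * a) ^ 2 + y ^ 2) := by
    nlinarith [sq_nonneg (p + b), sq_nonneg (p + q * a), sq_nonneg (p - y),
      sq_nonneg (b - q * a), sq_nonneg (b + y), sq_nonneg (q * a + y)]
  have e2 := mul_le_mul_of_nonneg_right h1 (sq_nonneg b)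
  have e3 := mul_le_mul_of_nonneg_right h1 (sq_nonneg (q * a))
  have e4 := mul_le_mul_of_nonneg_right h2 (sq_nonneg a)
  have e5 : 0 ≤ s * q ^ 2 * (q * a) ^ 2 := by positivity
  have e6 : 0 ≤ s * q ^ 2 * b ^ 2 := by positivity
  nlinarith

theorem local_error_pointwise {X a b c w w1 w2 N P Q t T : ℝ} (hN : 0 ≤ N)
    (hX : X ^ 2 ≤ t ^ 2 * N) (ht : t ^ 2 ≤ T ^ 2) (hb : b ^ 2 ≤ P) (hc : c ^ 2 ≤ Q)
    (hP : 0 ≤ P) (hQ : 0 ≤ Q) :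
    2 * (X * (3 * (a * w2) + 3 * (b * w1) + c * w)) ^ 2 ≤
      54 * N * (1 + T ^ 2 * P + T ^ 2 * Q) * (t ^ 2 * a ^ 2 * w2 ^ 2 + (w1 ^ 2 + w ^ 2)) := by
  have f2 : (3 * (a * w2) + 3 * (b * w1) + c * w) ^ 2 ≤
      27 * (a ^ 2 * w2 ^ 2 + P * w1 ^ 2 + Q * w ^ 2) := by
    have e1 := mul_le_mul_of_nonneg_right hb (sq_nonneg w1)
    have e2 := mul_le_mul_of_nonneg_right hc (sq_nonneg w)
    have e3 : 0 ≤ Q * w ^ 2 := by positivity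
    have e4 := sq_nonneg (3 * (a * w2) - 3 * (b * w1))
    have e5 := sq_nonneg (3 * (a * w2) - c * w)
    have e6 := sq_nonneg (3 * (b * w1) - c * w)
    linarith
  have f3 := mul_le_mul hX f2 (sq_nonneg _) (by positivity)
  have f5 : t ^ 2 * (a ^ 2 * w2 ^ 2 + P * w1 ^ 2 + Q * w ^ 2) ≤
      (1 + T ^ 2 * P + T ^ 2 * Q) * (t ^ 2 * a ^ 2 * w2 ^ 2 + (w1 ^ 2 + w ^ 2)) := by
    have g1 := mul_le_mul_of_nonneg_right ht (by positivity : 0 ≤ P * w1 ^ 2)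
    have g2 := mul_le_mul_of_nonneg_right ht (by positivity : 0 ≤ Q * w ^ 2)
    have g3 : 0 ≤ (T ^ 2 * P + T ^ 2 * Q) * (t ^ 2 * a ^ 2 * w2 ^ 2) := by positivity
    have g4 : 0 ≤ (1 + T ^ 2 * Q) * w1 ^ 2 := by positivity
    have g5 : 0 ≤ (1 + T ^ 2 * P) * w ^ 2 := by positivity
    linarith
  have f6 := mul_le_mul_of_nonneg_left f5 (by positivity : 0 ≤ 54 * N)
  linarith

/-- Carleman estimate for solutions, with the error terms localised to `[0, m]` up to a term that
is negligible for large `k`. -/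
theorem exists_carleman {T L m : ℝ} (hT : 0 < T) (hm : 0 < m) (hmL : m ≤ L)
    {χ χ1 χ2 χ3 : ℝ → ℝ} (hχ : IsCutoff m χ χ1 χ2 χ3) :
    ∃ K : ℝ, 0 < K ∧ ∃ k₀ : ℕ, ∀ k ≥ k₀, ∃ C : ℝ, 0 < C ∧ ∀ w w1 w2 w3 z z1 : ℝ → ℝ → ℝ,
      IsSolution T L w w1 w2 w3 z → (Continuous fun p : ℝ × ℝ => z1 p.1 p.2) →
      (∀ t x, HasDerivAt (fun r => w1 r x) (z1 t x) t) →
      (∀ t x, HasDerivAt (z t) (z1 t x) x) →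
        dInt T L (fun t x => (t * (T - t)) ^ (2 * (k + 1)) * (χ x ^ 2 * w t x ^ 2)) ≤
          C * (dInt T m (fun t x => t ^ 2 * χ1 x ^ 2 * w2 t x ^ 2) +
            dInt T m (fun t x => w1 t x ^ 2)) +
          K * ((k + 1 : ℝ) ^ 2 * Real.exp (-((k + 1) * L ^ 2))) *
            (T ^ 2 / 8) ^ (2 * (k + 1)) * dInt T L (fun t x => w t x ^ 2) := by
  have ⟨k0, k1, k2, k3, d, d1, d2, h0, h1, hl, hr⟩ := hχ
  have hL : 0 < L := hm.trans_le hmL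
  obtain ⟨μ, hμ⟩ : ∃ μ : ℝ, μ = T ^ 2 / 8 * Real.exp (-(2 * L ^ 2)) := ⟨_, rfl⟩
  have hμ0 : 0 < μ := by rw [hμ]; positivity
  obtain ⟨Z, hZ⟩ : ∃ Z : ℝ, Z = T ^ 2 / μ ^ 2 := ⟨_, rfl⟩
  have hZ0 : 0 < Z := by rw [hZ]; positivity
  obtain ⟨k₀, hk₀⟩ := exists_nat_ge (1 / L ^ 2 + (4 + 2 * Z) / (4 * L ^ 4))
  refine ⟨2 * Z, by positivity, k₀, fun k hk => ?_⟩
  obtain ⟨s, hs⟩ : ∃ s : ℝ, s = (k : ℝ) + 1 := ⟨_, rfl⟩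
  have hs1 : 1 ≤ s := by rw [hs]; simp
  have hs0 : 0 ≤ s := by linarith
  have hsk : 1 / L ^ 2 + (4 + 2 * Z) / (4 * L ^ 4) ≤ s := by
    have : (k₀ : ℝ) ≤ k := by exact_mod_cast hk
    linarith
  have hs2 : 1 ≤ s * L ^ 2 := by
    have e1 : 1 / L ^ 2 ≤ s := le_trans (by simp; positivity) hsk
    rwa [div_le_iff₀ (by positivity)] at e1
  have hs3 : 4 + 2 * Z ≤ s * (4 * L ^ 4) := by
    have e1 : (4 + 2 * Z) / (4 * L ^ 4) ≤ s := le_trans (by simp; positivity) hsk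
    rwa [div_le_iff₀ (by positivity)] at e1
  obtain ⟨q, hq⟩ : ∃ q : ℝ → ℝ, q = fun x => s * (2 * L - x) := ⟨_, rfl⟩
  have hq' : ∀ x, s * (2 * L - x) = q x := fun x => by rw [hq]
  have hqL : ∀ x ∈ Icc 0 L, s * L ≤ q x := fun x hx => by
    rw [hq]; exact mul_le_mul_of_nonneg_left (by linarith [hx.2]) hs0
  have cq : Continuous q := by rw [hq]; fun_prop
  have c1 : ∀ x ∈ Icc 0 L, 1 ≤ s * q x ^ 2 := fun x hx => by
    have e1 : (s * L) ^ 2 ≤ q x ^ 2 := pow_le_pow_left₀ (by positivity) (hqL x hx) 2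
    have e2 := mul_le_mul_of_nonneg_left e1 hs0
    have e3 : 1 ≤ s ^ 2 := one_le_pow₀ hs1
    nlinarith
  have c2 : ∀ x ∈ Icc 0 L, 3 * s ^ 3 + 2 * Z * s ^ 2 + 1 ≤ 4 * (s * q x ^ 4) := fun x hx => by
    have e1 : (s * L) ^ 4 ≤ q x ^ 4 := pow_le_pow_left₀ (by positivity) (hqL x hx) 4
    have e2 := mul_le_mul_of_nonneg_left e1 hs0
    have e3 : 1 ≤ s ^ 3 := one_le_pow₀ hs1
    have e4 : s ^ 2 ≤ s ^ 3 := pow_le_pow_right₀ hs1 (by norm_num)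
    have e5 : s ^ 3 ≤ s ^ 4 := pow_le_pow_right₀ hs1 (by norm_num)
    have e6 := mul_le_mul_of_nonneg_left hs3 (by positivity : 0 ≤ s ^ 4)
    have e7 := mul_le_mul_of_nonneg_left (e4.trans e5) hZ0.le
    nlinarith
  obtain ⟨Θ, hΘ⟩ : ∃ Θ : ℝ → ℝ, Θ = fun t => (t * (T - t)) ^ (k + 1) := ⟨_, rfl⟩
  obtain ⟨Θ', hΘ'⟩ : ∃ Θ' : ℝ → ℝ, Θ' = fun t => s * (t * (T - t)) ^ k * (T - 2 * t) := ⟨_, rfl⟩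
  have cΘ : Continuous Θ := by rw [hΘ]; fun_prop
  have cΘ' : Continuous Θ' := by rw [hΘ']; fun_prop
  have dΘ : ∀ t, HasDerivAt Θ (Θ' t) t := fun t => by
    rw [hΘ, hΘ']
    refine ((((hasDerivAt_id' t).fun_mul ((hasDerivAt_id' t).const_sub T)).fun_pow
      (k + 1))).congr_deriv ?_
    push_cast
    rw [hs]
    ring
  have hΘsq : ∀ t ∈ Icc 0 T, Θ' t ^ 2 ≤ Z * s ^ 2 * (Θ t ^ 2 + μ ^ (2 * (k + 1))) := fun t ht => by
    have e1 := sq_mul_pow_le hμ0.le (mul_nonneg ht.1 (sub_nonneg.2 ht.2)) k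
    have e2 : (T - 2 * t) ^ 2 ≤ T ^ 2 := by nlinarith [mul_nonneg ht.1 (sub_nonneg.2 ht.2)]
    have e3 : (t * (T - t)) ^ (2 * k) ≤ (Θ t ^ 2 + μ ^ (2 * (k + 1))) / μ ^ 2 := by
      rw [le_div_iff₀ (by positivity), hΘ]
      calc _ = μ ^ 2 * (t * (T - t)) ^ (2 * k) := by ring
        _ ≤ _ := e1
        _ = _ := by ring
    calc Θ' t ^ 2 = s ^ 2 * ((t * (T - t)) ^ (2 * k) * (T - 2 * t) ^ 2) := by rw [hΘ']; ring
      _ ≤ s ^ 2 * ((Θ t ^ 2 + μ ^ (2 * (k + 1))) / μ ^ 2 * T ^ 2) := by gcongr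
      _ = _ := by rw [hZ]; ring
  obtain ⟨E, hE⟩ : ∃ E : ℝ → ℝ, E = fun x => Real.exp (s * (2 * L - x) ^ 2 / 2) := ⟨_, rfl⟩
  have cE : Continuous E := by rw [hE]; fun_prop
  have dE : ∀ x, HasDerivAt E (-(s * (2 * L - x)) * E x) x := fun x => by
    rw [hE]
    exact ((((((hasDerivAt_id' x).const_sub (2 * L)).fun_pow 2).const_mul s).div_const 2).exp
      ).congr_deriv (by push_cast; ring)
  have hE2 : ∀ x, E x ^ 2 = Real.exp (s * (2 * L - x) ^ 2) := fun x => by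
    rw [hE, ← Real.exp_nat_mul]; congr 1; push_cast; ring
  have hElow : ∀ x ∈ Icc 0 L, Real.exp (s * L ^ 2) ≤ E x ^ 2 := fun x hx => by
    rw [hE2, Real.exp_le_exp]
    exact mul_le_mul_of_nonneg_left (pow_le_pow_left₀ hL.le (by linarith [hx.2]) 2) hs0
  have hEup : ∀ x ∈ Icc 0 L, μ ^ (2 * (k + 1)) * E x ^ 2 ≤ (T ^ 2 / 8) ^ (2 * (k + 1)) :=
      fun x hx => by
    have e1 : E x ^ 2 ≤ Real.exp (s * (2 * L) ^ 2) := by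
      rw [hE2, Real.exp_le_exp]
      exact mul_le_mul_of_nonneg_left
        (pow_le_pow_left₀ (by linarith [hx.2]) (by linarith [hx.1]) 2) hs0
    have e2 : Real.exp (-(2 * L ^ 2)) ^ (2 * (k + 1)) * Real.exp (s * (2 * L) ^ 2) = 1 := by
      rw [← Real.exp_nat_mul, ← Real.exp_add, Real.exp_eq_one_iff, hs]
      push_cast
      ring
    calc _ ≤ μ ^ (2 * (k + 1)) * Real.exp (s * (2 * L) ^ 2) := by gcongr
      _ = (T ^ 2 / 8) ^ (2 * (k + 1)) * (Real.exp (-(2 * L ^ 2)) ^ (2 * (k + 1)) *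
          Real.exp (s * (2 * L) ^ 2)) := by rw [hμ, mul_pow]; ring
      _ = _ := by rw [e2, mul_one]
  obtain ⟨A, hA, hA'⟩ := exists_bound (fun t => (t ^ k * (T - t) ^ (k + 1)) ^ 2) (by fun_prop) 0 T
  obtain ⟨B, hB, hB'⟩ := exists_bound (fun x => E x ^ 2) (by fun_prop) 0 m
  obtain ⟨P, hP, hP'⟩ := exists_bound (fun x => χ2 x ^ 2) (by fun_prop) 0 m
  obtain ⟨Q, hQ, hQ'⟩ := exists_bound (fun x => (χ3 x + χ1 x) ^ 2) (by fun_prop) 0 m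
  obtain ⟨D, hD⟩ : ∃ D : ℝ, D = 54 * (A * B) * (1 + T ^ 2 * P + T ^ 2 * Q) := ⟨_, rfl⟩
  have hD0 : 0 < D := by rw [hD]; positivity
  refine ⟨Real.exp (-(s * L ^ 2)) * (D * (1 + 4 * m ^ 2)), by positivity,
    fun w w1 w2 w3 z z1 S cz1 dt1 dzx => ?_⟩
  rw [← hs]
  have ⟨c, c1', c2', c3, ct, dx, dx1, dx2, dt, eq, l, r, r1⟩ := S
  have h := dInt_weighted_nonneg hT.le hL.le hs0 dΘ cΘ' (by simp [hΘ]) (by simp [hΘ]) dE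
    (U := fun t x => χ x * w t x) (U1 := fun t x => χ1 x * w t x + χ x * w1 t x)
    (U2 := fun t x => χ2 x * w t x + 2 * (χ1 x * w1 t x) + χ x * w2 t x)
    (U3 := fun t x => χ3 x * w t x + 3 * (χ2 x * w1 t x) + 3 * (χ1 x * w2 t x) + χ x * w3 t x)
    (Ut := fun t x => χ x * z t x) (U1t := fun t x => χ1 x * z t x + χ x * z1 t x)
    (by fun_prop) (by fun_prop) (by fun_prop) (by fun_prop) (by fun_prop) (by fun_prop)
    ?_ ?_ ?_ ?_ ?_ ?_ ?_ ?_
  · simp only [hq'] at h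
    have pt : ∀ t ∈ Icc 0 T, ∀ x ∈ Icc 0 L,
        1 / 2 * (E x * (Θ' t * (χ x * w t x) + Θ t * (χ x * z t x + (χ3 x * w t x +
          3 * (χ2 x * w1 t x) + 3 * (χ1 x * w2 t x) + χ x * w3 t x)))) ^ 2 -
        s * (18 * q x ^ 2 * (Θ t * E x * (χ1 x * w t x + χ x * w1 t x - q x * (χ x * w t x))) ^ 2 +
          9 * q x ^ 4 * (Θ t * E x * (χ x * w t x)) ^ 2) +
        3 * s ^ 3 * (Θ t * E x * (χ x * w t x)) ^ 2 ≤
        ((-Real.exp (s * L ^ 2)) * ((t * (T - t)) ^ (2 * (k + 1)) * (χ x ^ 2 * w t x ^ 2)) +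
          2 * Z * s ^ 2 * (T ^ 2 / 8) ^ (2 * (k + 1)) * w t x ^ 2) +
        2 * (Θ t * E x * (3 * (χ1 x * w2 t x) + 3 * (χ2 x * w1 t x) +
          (χ3 x + χ1 x) * w t x)) ^ 2 := fun t ht x hx => by
      have e1 := carleman_pointwise (a := Θ t * E x * (χ x * w t x))
        (b := Θ t * E x * (χ1 x * w t x + χ x * w1 t x - q x * (χ x * w t x)))
        (p := E x * (Θ' t * (χ x * w t x))) (W := μ ^ (2 * (k + 1)) * (E x * (χ x * w t x)) ^ 2)
        (y := Θ t * E x * (3 * (χ1 x * w2 t x) + 3 * (χ2 x * w1 t x) + (χ3 x + χ1 x) * w t x))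
        (by
          have := mul_le_mul_of_nonneg_right (hΘsq t ht) (sq_nonneg (E x * (χ x * w t x)))
          linarith) (c1 x hx) (c2 x hx)
      have e2 : E x * (Θ' t * (χ x * w t x) + Θ t * (χ x * z t x + (χ3 x * w t x +
          3 * (χ2 x * w1 t x) + 3 * (χ1 x * w2 t x) + χ x * w3 t x))) =
          E x * (Θ' t * (χ x * w t x)) -
            Θ t * E x * (χ1 x * w t x + χ x * w1 t x - q x * (χ x * w t x)) -
            q x * (Θ t * E x * (χ x * w t x)) +
            Θ t * E x * (3 * (χ1 x * w2 t x) + 3 * (χ2 x * w1 t x) + (χ3 x + χ1 x) * w t x) := by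
        rw [eq t ht x hx]
        ring
      rw [e2]
      refine e1.trans ?_
      have e3 : 0 ≤ Θ t ^ 2 * (χ x ^ 2 * w t x ^ 2) := by positivity
      have e4 := mul_le_mul_of_nonneg_right (hElow x hx) e3
      have e5 : (t * (T - t)) ^ (2 * (k + 1)) = Θ t ^ 2 := by rw [hΘ]; ring
      have e6 := mul_le_mul_of_nonneg_right (hEup x hx) (sq_nonneg (χ x * w t x))
      have e7 : (χ x * w t x) ^ 2 ≤ w t x ^ 2 := by
        rw [mul_pow]
        exact mul_le_of_le_one_left (sq_nonneg _) (pow_le_one₀ (h0 x) (h1 x))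
      have e8 := mul_le_mul_of_nonneg_left e7
        (by positivity : 0 ≤ (T ^ 2 / 8) ^ (2 * (k + 1)))
      have e9 := mul_le_mul_of_nonneg_left (e6.trans e8) (by positivity : 0 ≤ 2 * Z * s ^ 2)
      rw [e5]
      linarith
    have h2 := h.trans (dInt_le_add_of_le hT.le hm.le hmL
      (G := fun t x => (-Real.exp (s * L ^ 2)) *
          ((t * (T - t)) ^ (2 * (k + 1)) * (χ x ^ 2 * w t x ^ 2)) +
        2 * Z * s ^ 2 * (T ^ 2 / 8) ^ (2 * (k + 1)) * w t x ^ 2)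
      (H := fun t x => D * (t ^ 2 * χ1 x ^ 2 * w2 t x ^ 2 + (w1 t x ^ 2 + w t x ^ 2)))
      (by fun_prop) (by fun_prop) (by fun_prop) ?_ ?_)
    · rw [dInt_add _ _ (by fun_prop) (by fun_prop), dInt_const_mul, dInt_const_mul,
        dInt_const_mul, dInt_add _ _ (by fun_prop) (by fun_prop),
        dInt_add _ _ (by fun_prop) (by fun_prop)] at h2
      have e1 := dInt_sq_le hT.le hm.le S
      have e2 : 0 ≤ dInt T m (fun t x => t ^ 2 * χ1 x ^ 2 * w2 t x ^ 2) :=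
        dInt_nonneg hT.le hm.le fun t _ x _ => by positivity
      have e3 : dInt T m (fun t x => t ^ 2 * χ1 x ^ 2 * w2 t x ^ 2) +
          (dInt T m (fun t x => w1 t x ^ 2) + dInt T m (fun t x => w t x ^ 2)) ≤
          (1 + 4 * m ^ 2) * (dInt T m (fun t x => t ^ 2 * χ1 x ^ 2 * w2 t x ^ 2) +
            dInt T m (fun t x => w1 t x ^ 2)) := by
        have := mul_nonneg (by positivity : 0 ≤ 4 * m ^ 2) e2
        linarith
      have e4 := mul_le_mul_of_nonneg_left e3 hD0.le
      have e5 : Real.exp (s * L ^ 2) *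
          dInt T L (fun t x => (t * (T - t)) ^ (2 * (k + 1)) * (χ x ^ 2 * w t x ^ 2)) ≤
          D * ((1 + 4 * m ^ 2) * (dInt T m (fun t x => t ^ 2 * χ1 x ^ 2 * w2 t x ^ 2) +
            dInt T m (fun t x => w1 t x ^ 2))) + 2 * Z * s ^ 2 * (T ^ 2 / 8) ^ (2 * (k + 1)) *
            dInt T L (fun t x => w t x ^ 2) := by linarith
      have e6 := mul_le_mul_of_nonneg_left e5 (Real.exp_pos (-(s * L ^ 2))).le
      rw [← mul_assoc, ← Real.exp_add, neg_add_cancel, Real.exp_zero, one_mul] at e6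
      refine e6.trans (le_of_eq ?_)
      ring
    · intro t ht x hx
      refine (pt t ht x ⟨hx.1, hx.2.trans hmL⟩).trans ?_
      refine add_le_add le_rfl ?_
      have e1 : (Θ t * E x) ^ 2 ≤ t ^ 2 * (A * B) := by
        have e1 : Θ t ^ 2 = t ^ 2 * (t ^ k * (T - t) ^ (k + 1)) ^ 2 := by
          simp only [hΘ, mul_pow]
          ring
        rw [mul_pow, e1, mul_assoc]
        exact mul_le_mul_of_nonneg_left (mul_le_mul ((le_abs_self _).trans (hA' t ht))
          ((le_abs_self _).trans (hB' x hx)) (sq_nonneg _) hA.le) (sq_nonneg t)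
      have e2 := local_error_pointwise (a := χ1 x) (w := w t x) (w1 := w1 t x) (w2 := w2 t x)
        (by positivity) e1 (pow_le_pow_left₀ ht.1 ht.2 2)
        ((le_abs_self _).trans (hP' x hx)) ((le_abs_self _).trans (hQ' x hx)) hP.le hQ.le
      rw [hD]
      exact e2
    · intro t ht x hx
      refine (pt t ht x ⟨hm.le.trans hx.1, hx.2⟩).trans (le_of_eq ?_)
      simp [hr x hx.1]
  · intro t x
    exact ((d x).fun_mul (dx t x)).congr_deriv (by ring)
  · intro t x
    exact (((d1 x).fun_mul (dx t x)).fun_add ((d x).fun_mul (dx1 t x))).congr_deriv (by ring)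
  · intro t x
    exact ((((d2 x).fun_mul (dx t x)).fun_add (((d1 x).fun_mul (dx1 t x)).const_mul 2)).fun_add
      ((d x).fun_mul (dx2 t x))).congr_deriv (by ring)
  · intro t x
    exact (dt t x).const_mul _
  · intro t x
    exact ((dt t x).const_mul _).fun_add ((dt1 t x).const_mul _)
  · intro t x
    exact ((d x).fun_mul (dzx t x)).congr_deriv (by ring)
  · intro t ht
    simp [hl 0 (by linarith)]
  · intro t ht
    simp [r t ht, r1 t ht]

section Smooth

open Function

variable {f : ℝ → ℝ → ℝ}

theorem pdx_eq_fderiv (hf : ContDiff ℝ (⊤ : ℕ∞) (uncurry f)) (t x : ℝ) :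
    HasDerivAt (f t) (fderiv ℝ (uncurry f) (t, x) (0, 1)) x :=
  ((hf.differentiable (by simp) (t, x)).hasFDerivAt).comp_hasDerivAt x
    ((hasDerivAt_const x t).prodMk (hasDerivAt_id x))

theorem pdt_eq_fderiv (hf : ContDiff ℝ (⊤ : ℕ∞) (uncurry f)) (t x : ℝ) :
    HasDerivAt (fun s => f s x) (fderiv ℝ (uncurry f) (t, x) (1, 0)) t :=
  ((hf.differentiable (by simp) (t, x)).hasFDerivAt).comp_hasDerivAt (f := fun s => (s, x)) t
    ((hasDerivAt_id t).prodMk (hasDerivAt_const t x))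

theorem uncurry_pdx (hf : ContDiff ℝ (⊤ : ℕ∞) (uncurry f)) :
    uncurry (pdx f) = fun p => fderiv ℝ (uncurry f) p (0, 1) :=
  funext fun p => (pdx_eq_fderiv hf p.1 p.2).deriv

theorem uncurry_pdt (hf : ContDiff ℝ (⊤ : ℕ∞) (uncurry f)) :
    uncurry (pdt f) = fun p => fderiv ℝ (uncurry f) p (1, 0) :=
  funext fun p => (pdt_eq_fderiv hf p.1 p.2).deriv

theorem contDiff_pdx (hf : ContDiff ℝ (⊤ : ℕ∞) (uncurry f)) :
    ContDiff ℝ (⊤ : ℕ∞) (uncurry (pdx f)) := by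
  rw [uncurry_pdx hf]
  exact (hf.fderiv_right (m := (⊤ : ℕ∞)) (by simp)).clm_apply contDiff_const

theorem contDiff_pdt (hf : ContDiff ℝ (⊤ : ℕ∞) (uncurry f)) :
    ContDiff ℝ (⊤ : ℕ∞) (uncurry (pdt f)) := by
  rw [uncurry_pdt hf]
  exact (hf.fderiv_right (m := (⊤ : ℕ∞)) (by simp)).clm_apply contDiff_const

theorem hasDerivAt_pdx (hf : ContDiff ℝ (⊤ : ℕ∞) (uncurry f)) (t x : ℝ) :
    HasDerivAt (f t) (pdx f t x) x :=
  (pdx_eq_fderiv hf t x).differentiableAt.hasDerivAt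

theorem hasDerivAt_pdt (hf : ContDiff ℝ (⊤ : ℕ∞) (uncurry f)) (t x : ℝ) :
    HasDerivAt (fun s => f s x) (pdt f t x) t :=
  (pdt_eq_fderiv hf t x).differentiableAt.hasDerivAt

theorem pdt_pdx (hf : ContDiff ℝ (⊤ : ℕ∞) (uncurry f)) : pdt (pdx f) = pdx (pdt f) := by
  ext t x
  have two_le : (1 + 1 : WithTop ℕ∞) ≤ ((⊤ : ℕ∞) : WithTop ℕ∞) := by
    rw [one_add_one_eq_two]
    exact WithTop.coe_le_coe.2 (le_top : (2 : ℕ∞) ≤ ⊤)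
  have h1 := (pdt_eq_fderiv (contDiff_pdx hf) t x).deriv
  have h2 := (pdx_eq_fderiv (contDiff_pdt hf) t x).deriv
  have hd : DifferentiableAt ℝ (fderiv ℝ (uncurry f)) (t, x) :=
    (hf.fderiv_right (m := 1) two_le).differentiable (by simp) _
  have hs : IsSymmSndFDerivAt ℝ (uncurry f) (t, x) :=
    hf.contDiffAt.isSymmSndFDerivAt (by simpa [one_add_one_eq_two] using two_le)
  rw [uncurry_pdx hf, fderiv_clm_apply hd (differentiableAt_const _)] at h1
  rw [uncurry_pdt hf, fderiv_clm_apply hd (differentiableAt_const _)] at h2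
  simp only [fderiv_fun_const] at h1 h2
  simp at h1 h2
  change deriv (fun s => pdx f s x) t = deriv (pdt f t) x
  rw [h1, h2]
  exact hs _ _

end Smooth

theorem eq_zero_of_forall_mem_Ioo {g : ℝ → ℝ} (hg : Continuous g) {T : ℝ} (hT : 0 < T)
    (h : ∀ t ∈ Ioo 0 T, g t = 0) : ∀ t ∈ Icc 0 T, g t = 0 := by
  rw [← closure_Ioo hT.ne]
  exact fun t ht => EqOn.closure (s := Ioo 0 T) (f := g) (g := fun _ => 0) h hg
    continuous_const ht

theorem IsSolution.of_contDiff {T L : ℝ} (hT : 0 < T) (hL : 0 < L) {u : ℝ → ℝ → ℝ}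
    (hu : ContDiff ℝ (⊤ : ℕ∞) (Function.uncurry u))
    (heq : ∀ t ∈ Ioo 0 T, ∀ x ∈ Ioo 0 L, pdt u t x + pdx u t x + pdx (pdx (pdx u)) t x = 0)
    (left : ∀ t ∈ Icc 0 T, u t 0 = 0) (right : ∀ t ∈ Icc 0 T, u t L = 0)
    (right1 : ∀ t ∈ Icc 0 T, pdx u t L = 0) :
    IsSolution T L u (pdx u) (pdx (pdx u)) (pdx (pdx (pdx u))) (pdt u) := by
  have h1 := contDiff_pdx hu
  have h2 := contDiff_pdx h1
  have h3 := contDiff_pdx h2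
  have ht := contDiff_pdt hu
  refine ⟨hu.continuous, h1.continuous, h2.continuous, h3.continuous, ht.continuous,
    hasDerivAt_pdx hu, hasDerivAt_pdx h1, hasDerivAt_pdx h2, hasDerivAt_pdt hu, ?_, left, right,
    right1⟩
  have c1 : Continuous fun p : ℝ × ℝ => pdx u p.1 p.2 := h1.continuous
  have c3 : Continuous fun p : ℝ × ℝ => pdx (pdx (pdx u)) p.1 p.2 := h3.continuous
  have ct : Continuous fun p : ℝ × ℝ => pdt u p.1 p.2 := ht.continuous
  have e1 : ∀ t ∈ Ioo 0 T, ∀ x ∈ Icc 0 L, pdt u t x + pdx u t x + pdx (pdx (pdx u)) t x = 0 :=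
    fun t ht => eq_zero_of_forall_mem_Ioo (by fun_prop) hL (heq t ht)
  intro t ht x hx
  have e2 := eq_zero_of_forall_mem_Ioo
    (g := fun t => pdt u t x + pdx u t x + pdx (pdx (pdx u)) t x) (by fun_prop) hT
    (fun t ht => e1 t ht x hx) t ht
  linarith

theorem pdt_eq_zero {T : ℝ} (hT : 0 < T) {u : ℝ → ℝ → ℝ}
    (hu : ContDiff ℝ (⊤ : ℕ∞) (Function.uncurry u)) {x : ℝ} (h : ∀ t ∈ Ioo 0 T, u t x = 0) :
    ∀ t ∈ Icc 0 T, pdt u t x = 0 := by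
  have c : Continuous fun p : ℝ × ℝ => pdt u p.1 p.2 := (contDiff_pdt hu).continuous
  exact eq_zero_of_forall_mem_Ioo (by fun_prop) hT (deriv_eq_zero_of_forall_mem isOpen_Ioo h)

/-- The time derivative of a smooth solution is again a solution. -/
theorem IsSolution.pdt_of_contDiff {T L : ℝ} (hT : 0 < T) (hL : 0 < L) {u : ℝ → ℝ → ℝ}
    (hu : ContDiff ℝ (⊤ : ℕ∞) (Function.uncurry u))
    (heq : ∀ t ∈ Ioo 0 T, ∀ x ∈ Ioo 0 L, pdt u t x + pdx u t x + pdx (pdx (pdx u)) t x = 0)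
    (left : ∀ t ∈ Icc 0 T, u t 0 = 0) (right : ∀ t ∈ Icc 0 T, u t L = 0)
    (right1 : ∀ t ∈ Icc 0 T, pdx u t L = 0) :
    IsSolution T L (pdt u) (pdx (pdt u)) (pdx (pdx (pdt u))) (pdx (pdx (pdx (pdt u))))
      (pdt (pdt u)) := by
  have h1 := contDiff_pdx hu
  have h2 := contDiff_pdx h1
  have h3 := contDiff_pdx h2
  have ht := contDiff_pdt hu
  refine IsSolution.of_contDiff hT hL ht (fun t ht' x hx => ?_)
    (pdt_eq_zero hT hu fun t ht => left t (Ioo_subset_Icc_self ht))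
    (pdt_eq_zero hT hu fun t ht => right t (Ioo_subset_Icc_self ht)) ?_
  · have e := deriv_eq_zero_of_forall_mem isOpen_Ioo (fun s hs => heq s hs x hx) t ht'
    rw [(((hasDerivAt_pdt ht t x).fun_add (hasDerivAt_pdt h1 t x)).fun_add
      (hasDerivAt_pdt h3 t x)).deriv] at e
    rwa [pdt_pdx h2, pdt_pdx h1, pdt_pdx hu] at e
  · rw [← pdt_pdx hu]
    exact pdt_eq_zero hT h1 fun t ht => right1 t (Ioo_subset_Icc_self ht)

theorem exists_sq_mul_exp_neg_le {L ε : ℝ} (hL : 0 < L) (hε : 0 < ε) (k₀ : ℕ) :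
    ∃ k ≥ k₀, (k + 1 : ℝ) ^ 2 * Real.exp (-((k + 1) * L ^ 2)) ≤ ε := by
  have h1 : Filter.Tendsto (fun k : ℕ => ((k : ℝ) + 1) * L ^ 2) Filter.atTop Filter.atTop :=
    (Filter.tendsto_atTop_add_const_right _ 1 tendsto_natCast_atTop_atTop).atTop_mul_const
      (by positivity)
  have h2 := (Real.tendsto_pow_mul_exp_neg_atTop_nhds_zero 2).comp h1
  have h3 := h2.eventually_le_const (show 0 < ε * L ^ 4 by positivity)
  obtain ⟨k, hk, hk'⟩ := (h3.and (Filter.eventually_ge_atTop k₀)).exists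
  refine ⟨k, hk', ?_⟩
  have hL4 : 0 < L ^ 4 := by positivity
  refine le_of_mul_le_mul_right ?_ hL4
  calc _ = (((k : ℝ) + 1) * L ^ 2) ^ 2 * Real.exp (-((k + 1) * L ^ 2)) := by ring
    _ ≤ _ := hk

theorem exists_observability {T L m : ℝ} (hT : 0 < T) (hm : 0 < m) (hmL : m ≤ L) :
    ∃ C : ℝ, 0 < C ∧ ∀ w w1 w2 w3 z z1 z2 z3 zt : ℝ → ℝ → ℝ,
      IsSolution T L w w1 w2 w3 z → IsSolution T L z z1 z2 z3 zt →
      (∀ t x, HasDerivAt (fun r => w1 r x) (z1 t x) t) →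
        ∫ x in (0:ℝ)..L, x * w 0 x ^ 2 ≤ C * dInt T m (fun t x => w1 t x ^ 2) := by
  have hL : 0 < L := hm.trans_le hmL
  obtain ⟨χ, χ1, χ2, χ3, hχ⟩ := exists_isCutoff hm
  obtain ⟨c₀, hc₀, energy⟩ := exists_energy_bound hT hm hmL hχ
  obtain ⟨K, hK, k₀, carleman⟩ := exists_carleman hT hm hmL hχ
  obtain ⟨C4, hC4, smoothing⟩ := exists_smoothing hT hL
  obtain ⟨X, hX⟩ : ∃ X : ℝ, X = Real.exp (L * T) := ⟨_, rfl⟩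
  have hX0 : 0 < X := by rw [hX]; positivity
  obtain ⟨k, hk, hσ⟩ := exists_sq_mul_exp_neg_le hL
    (show 0 < c₀ / (16 * K * L ^ 2 * X) by positivity) k₀
  obtain ⟨C1, hC1, energy⟩ := energy (k + 1)
  obtain ⟨C2, hC2, carleman⟩ := carleman k hk
  obtain ⟨M, hM⟩ : ∃ M : ℝ, M = (T ^ 2 / 8) ^ (2 * (k + 1)) := ⟨_, rfl⟩
  have hM0 : 0 < M := by rw [hM]; positivity
  obtain ⟨C3, hC3, interior⟩ := exists_local_bound hT hm hmL hχ
    (show 0 < c₀ * M / (4 * C2 * C4 * X) by positivity)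
  refine ⟨2 * (C1 + C2 + C2 * C3) / (c₀ * M), by positivity,
    fun w w1 w2 w3 z z1 z2 z3 zt S S' dt1 => ?_⟩
  have h1 := energy w w1 w2 w3 z S
  have h2 := carleman w w1 w2 w3 z z1 S S'.cont1 dt1 S'.dx
  have h3 := interior w w1 w2 w3 z S
  have h4 := smoothing w w1 w2 w3 z z1 z2 z3 zt S S'
  have h5 := S.dInt_deriv_sq_le hT.le hL.le
  have h6 := dInt_sq_le hT.le hL.le S
  have hE0 : 0 ≤ ∫ x in (0:ℝ)..L, x * w 0 x ^ 2 :=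
    intervalIntegral.integral_nonneg hL.le fun x hx => mul_nonneg hx.1 (sq_nonneg _)
  rw [← hM] at h1 h2
  rw [← hX] at h5
  obtain ⟨e, he⟩ : ∃ e, e = ∫ x in (0:ℝ)..L, x * w 0 x ^ 2 := ⟨_, rfl⟩
  obtain ⟨σ, hσ'⟩ : ∃ σ, σ = (k + 1 : ℝ) ^ 2 * Real.exp (-((k + 1) * L ^ 2)) := ⟨_, rfl⟩
  have hσ0 : 0 ≤ σ := by rw [hσ']; positivity
  rw [← he] at h1 h5 hE0 ⊢
  rw [← hσ'] at h2 hσ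
  have i1 := mul_le_mul_of_nonneg_left h3 hC2.le
  have i2 := mul_le_mul_of_nonneg_left (h4.trans (mul_le_mul_of_nonneg_left h5 hC4.le))
    (by positivity : 0 ≤ C2 * (c₀ * M / (4 * C2 * C4 * X)))
  have i3 : C2 * (c₀ * M / (4 * C2 * C4 * X)) * (C4 * (X * e)) = c₀ * M / 4 * e := by
    field_simp
  have i4 := mul_le_mul_of_nonneg_left
    (h6.trans (mul_le_mul_of_nonneg_left h5 (by positivity : 0 ≤ 4 * L ^ 2)))
    (by positivity : 0 ≤ K * σ * M)
  have i5 := mul_le_mul_of_nonneg_left hσ (by positivity : 0 ≤ K * M * (4 * L ^ 2 * (X * e)))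
  have i6 : K * M * (4 * L ^ 2 * (X * e)) * (c₀ / (16 * K * L ^ 2 * X)) = c₀ * M / 4 * e := by
    field_simp
    ring
  rw [div_mul_eq_mul_div, le_div_iff₀ (by positivity)]
  linarith

end KdV

/-- observability inequality for the linear KdV equation in the
weighted space `L²_{x dx}` with observation of `w_x` on `(0, ν/2)`:
`∫ x w(0,x)² dx ≤ C ∫₀^T ∫₀^{ν/2} w_x² dx dt`. -/
theorem stmt_18 (L T ν : ℝ) (hL : 0 < L) (hT : 0 < T) (hν0 : 0 < ν) (hνL : ν < L) :
    ∃ C : ℝ, 0 < C ∧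
      ∀ w : ℝ → ℝ → ℝ, ContDiff ℝ (⊤ : ℕ∞) (Function.uncurry w) →
        (∀ t ∈ Set.Ioo (0:ℝ) T, ∀ x ∈ Set.Ioo (0:ℝ) L,
          pdt w t x + pdx w t x + pdx (pdx (pdx w)) t x = 0) →
        (∀ t ∈ Set.Icc (0:ℝ) T, w t 0 = 0 ∧ w t L = 0 ∧ pdx w t L = 0) →
        (∫ x in (0:ℝ)..L, x * (w 0 x) ^ 2) ≤
          C * ∫ t in (0:ℝ)..T, ∫ x in (0:ℝ)..(ν / 2), (pdx w t x) ^ 2 := by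
  obtain ⟨C, hC, h⟩ := KdV.exists_observability (m := ν / 2) hT (by linarith)
    (by linarith : ν / 2 ≤ L)
  refine ⟨C, hC, fun w hw heq hb => h _ _ _ _ _ _ _ _ _
    (KdV.IsSolution.of_contDiff hT hL hw heq (fun t ht => (hb t ht).1) (fun t ht => (hb t ht).2.1)
      fun t ht => (hb t ht).2.2)
    (KdV.IsSolution.pdt_of_contDiff hT hL hw heq (fun t ht => (hb t ht).1)
      (fun t ht => (hb t ht).2.1) fun t ht => (hb t ht).2.2) fun t x => ?_⟩
  rw [← KdV.pdt_pdx hw]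
  exact KdV.hasDerivAt_pdt (KdV.contDiff_pdx hw) t x
end
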